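/- arXiv:2308.16543 — 3 statements merged into one kernel-verified Lean document; each statement's English description precedes it below -/
import Mathlib

section
/- Let n ≥ 1, let Ω ⊂ ℝ^n be open, let f ∈ L^1_loc(Ω), let ε > 0 and δ > 0, and let Ω' ⋐ Ω be an open set with dist(Ω', ℝ^n \ Ω) > δ. Let ρ be a standard (smooth, nonnegative, compactly supported in the unit ball, unit-mass) mollifier and ρ_δ(x) := δ^{-n} ρ(x/δ). Then κ_ε(ρ_δ * f, Ω') ≤ κ_ε(f, Ω). -/
open MeasureTheory Filter Topology Metric
open scoped ENNReal RealInnerProductSpace Classical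

noncomputable section

/-- An open cube in `ℝⁿ` with side length `ε` and arbitrary orientation. -/
def IsCube (n : ℕ) (ε : ℝ) (Q : Set (EuclideanSpace ℝ (Fin n))) : Prop :=
  ∃ (T : EuclideanSpace ℝ (Fin n) ≃ₗᵢ[ℝ] EuclideanSpace ℝ (Fin n))
    (x : EuclideanSpace ℝ (Fin n)),
    Q = (fun y => x + T y) '' {y : EuclideanSpace ℝ (Fin n) | ∀ i, |y i| < ε / 2}

/-- The BMO-type functional `κ_ε(f, Ω)`. -/
def kappa (n : ℕ) (ε : ℝ) (f : EuclideanSpace ℝ (Fin n) → ℝ)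
    (Ω : Set (EuclideanSpace ℝ (Fin n))) : ℝ≥0∞ :=
  ENNReal.ofReal (ε ^ (n - 1)) *
    ⨆ (F : Set (Set (EuclideanSpace ℝ (Fin n))))
      (_ : ∀ Q ∈ F, IsCube n ε Q ∧ Q ⊆ Ω) (_ : F.Pairwise Disjoint),
      ∑' Q : F, ENNReal.ofReal
        (⨍ x in (Q : Set (EuclideanSpace ℝ (Fin n))),
          |f x - ⨍ y in (Q : Set (EuclideanSpace ℝ (Fin n))), f y ∂volume| ∂volume)

/-- The divergence of a vector field on `ℝⁿ`. -/
def vdiv (n : ℕ) (Φ : EuclideanSpace ℝ (Fin n) → EuclideanSpace ℝ (Fin n))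
    (x : EuclideanSpace ℝ (Fin n)) : ℝ :=
  ∑ i : Fin n, fderiv ℝ Φ x (EuclideanSpace.single i 1) i

/-- The variation `Var(f, Ω)`. -/
def variation (n : ℕ) (f : EuclideanSpace ℝ (Fin n) → ℝ)
    (Ω : Set (EuclideanSpace ℝ (Fin n))) : ℝ≥0∞ :=
  ⨆ (Φ : EuclideanSpace ℝ (Fin n) → EuclideanSpace ℝ (Fin n))
    (_ : ContDiff ℝ 1 Φ) (_ : HasCompactSupport Φ) (_ : tsupport Φ ⊆ Ω)
    (_ : ∀ x, ‖Φ x‖ ≤ 1),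
    ENNReal.ofReal (∫ x in Ω, f x * vdiv n Φ x)

/-- The approximate jump set `J_f`. -/
def jumpSet (n : ℕ) (f : EuclideanSpace ℝ (Fin n) → ℝ) : Set (EuclideanSpace ℝ (Fin n)) :=
  {x | ∃ ν : EuclideanSpace ℝ (Fin n), ‖ν‖ = 1 ∧ ∃ a b : ℝ, a ≠ b ∧
    Tendsto (fun r : ℝ =>
        ⨍ y in {y ∈ ball x r | 0 < ⟪y - x, ν⟫}, |f y - a| ∂volume)
      (𝓝[>] 0) (𝓝 0) ∧
    Tendsto (fun r : ℝ =>
        ⨍ y in {y ∈ ball x r | ⟪y - x, ν⟫ < 0}, |f y - b| ∂volume)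
      (𝓝[>] 0) (𝓝 0)}

/-- The approximate discontinuity set `S_f` (the set of non-Lebesgue points). -/
def approxDiscontSet (n : ℕ) (f : EuclideanSpace ℝ (Fin n) → ℝ) :
    Set (EuclideanSpace ℝ (Fin n)) :=
  {x | ¬ ∃ c : ℝ,
    Tendsto (fun r : ℝ => ⨍ y in ball x r, |f y - c| ∂volume) (𝓝[>] 0) (𝓝 0)}

/-- `(μ, σ)` is the polar decomposition `Df = σ |Df|` of the gradient measure of `f` on `Ω`:
`μ` plays the role of the total variation measure `|Df|` and `σ` of the polar vector field. -/
def IsVariationPair (n : ℕ) (f : EuclideanSpace ℝ (Fin n) → ℝ)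
    (Ω : Set (EuclideanSpace ℝ (Fin n))) (μ : Measure (EuclideanSpace ℝ (Fin n)))
    (σ : EuclideanSpace ℝ (Fin n) → EuclideanSpace ℝ (Fin n)) : Prop :=
  IsFiniteMeasure μ ∧ μ Ωᶜ = 0 ∧ AEStronglyMeasurable σ μ ∧ (∀ᵐ x ∂μ, ‖σ x‖ = 1) ∧
  ∀ Φ : EuclideanSpace ℝ (Fin n) → EuclideanSpace ℝ (Fin n),
    ContDiff ℝ 1 Φ → HasCompactSupport Φ → tsupport Φ ⊆ Ω →
    ∫ x in Ω, f x * vdiv n Φ x = - ∫ x, ⟪Φ x, σ x⟫ ∂μ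

/-- `|D^a f|(Ω)`, the total variation of the absolutely continuous part of `Df`,
with the convention that it is `∞` if `f` is not of bounded variation in `Ω`. -/
def absVar (n : ℕ) (f : EuclideanSpace ℝ (Fin n) → ℝ)
    (Ω : Set (EuclideanSpace ℝ (Fin n))) : ℝ≥0∞ :=
  if h : ∃ p : Measure (EuclideanSpace ℝ (Fin n)) ×
      (EuclideanSpace ℝ (Fin n) → EuclideanSpace ℝ (Fin n)),
      IsVariationPair n f Ω p.1 p.2 then
    volume.withDensity ((h.choose.1).rnDeriv volume) Ω
  else ⊤

/-- `|D^c f|(Ω)`, the total variation of the Cantor part of `Df`,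
with the convention that it is `∞` if `f` is not of bounded variation in `Ω`. -/
def cantorVar (n : ℕ) (f : EuclideanSpace ℝ (Fin n) → ℝ)
    (Ω : Set (EuclideanSpace ℝ (Fin n))) : ℝ≥0∞ :=
  if h : ∃ p : Measure (EuclideanSpace ℝ (Fin n)) ×
      (EuclideanSpace ℝ (Fin n) → EuclideanSpace ℝ (Fin n)),
      IsVariationPair n f Ω p.1 p.2 then
    (h.choose.1.singularPart volume) (Ω \ approxDiscontSet n f)
  else ⊤

/-- `|D^j f|(Ω)`, the total variation of the jump part of `Df`,
with the convention that it is `∞` if `f` is not of bounded variation in `Ω`. -/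
def jumpVar (n : ℕ) (f : EuclideanSpace ℝ (Fin n) → ℝ)
    (Ω : Set (EuclideanSpace ℝ (Fin n))) : ℝ≥0∞ :=
  if h : ∃ p : Measure (EuclideanSpace ℝ (Fin n)) ×
      (EuclideanSpace ℝ (Fin n) → EuclideanSpace ℝ (Fin n)),
      IsVariationPair n f Ω p.1 p.2 then
    (h.choose.1.singularPart volume) (jumpSet n f ∩ Ω)
  else ⊤

/-- `g` is the weak (distributional) gradient of `u` on `Ω`. -/
def HasWeakGradientOn (n : ℕ) (u : EuclideanSpace ℝ (Fin n) → ℝ)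
    (g : EuclideanSpace ℝ (Fin n) → EuclideanSpace ℝ (Fin n))
    (Ω : Set (EuclideanSpace ℝ (Fin n))) : Prop :=
  ∀ φ : EuclideanSpace ℝ (Fin n) → ℝ,
    ContDiff ℝ 1 φ → HasCompactSupport φ → tsupport φ ⊆ Ω →
    ∀ k : Fin n,
      ∫ x in Ω, u x * fderiv ℝ φ x (EuclideanSpace.single k 1) =
        - ∫ x in Ω, φ x * g x k

/-- `f ∈ BV(Ω)`: `f` is integrable on `Ω` and has finite variation in `Ω`. -/
def IsBVOn (n : ℕ) (f : EuclideanSpace ℝ (Fin n) → ℝ)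
    (Ω : Set (EuclideanSpace ℝ (Fin n))) : Prop :=
  IntegrableOn f Ω volume ∧ variation n f Ω < ⊤

/-- `f ∈ SBV(Ω)`: `f ∈ BV(Ω)` and the Cantor part of `Df` vanishes. -/
def IsSBVOn (n : ℕ) (f : EuclideanSpace ℝ (Fin n) → ℝ)
    (Ω : Set (EuclideanSpace ℝ (Fin n))) : Prop :=
  IsBVOn n f Ω ∧ cantorVar n f Ω = 0

/-- The mean oscillation of `f` on `Q`. -/
def meanOsc {E : Type*} [MeasureSpace E] (f : E → ℝ) (Q : Set E) : ℝ :=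
  ⨍ x in Q, |f x - ⨍ y in Q, f y|

lemma setLIntegral_enorm_sub_setAverage {E : Type*} [MeasureSpace E]
    {f : E → ℝ} {Q : Set E} (hQ₀ : volume Q ≠ 0)
    (hQ₁ : volume Q ≠ ⊤) (hf : IntegrableOn f Q) :
    ∫⁻ x in Q, ‖f x - ⨍ y in Q, f y‖ₑ = volume Q * ENNReal.ofReal (meanOsc f Q) := by
  have hfin : Fact (volume Q < ⊤) := ⟨hQ₁.lt_top⟩
  have hint : Integrable (fun x => f x - ⨍ y in Q, f y) (volume.restrict Q) :=
    hf.sub (integrable_const _)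
  rw [← ofReal_integral_norm_eq_lintegral_enorm hint, meanOsc, setAverage_eq _ (fun x => |_|),
    smul_eq_mul, ENNReal.ofReal_mul (by positivity), measureReal_def,
    ENNReal.ofReal_inv_of_pos (ENNReal.toReal_pos hQ₀ hQ₁), ENNReal.ofReal_toReal hQ₁,
    ← mul_assoc, ENNReal.mul_inv_cancel hQ₀ hQ₁, one_mul]
  rfl

/-- Averaging in a parameter over a probability space does not increase the mean oscillation. -/
lemma ofReal_integral_abs_integral_sub_le {X Z : Type*} [MeasurableSpace X] [MeasurableSpace Z]
    (ν : Measure X) [IsProbabilityMeasure ν] (μ : Measure Z) [IsProbabilityMeasure μ]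
    (u : X → Z → ℝ) (hm : Measurable (Function.uncurry u))
    (hu : Integrable (Function.uncurry u) (ν.prod μ)) :
    ENNReal.ofReal (∫ x, |(∫ z, u x z ∂μ) - ∫ x', (∫ z, u x' z ∂μ) ∂ν| ∂ν) ≤
      ∫⁻ z, ENNReal.ofReal (∫ x, |u x z - ∫ x', u x' z ∂ν| ∂ν) ∂μ := by
  have hmean : Measurable fun z => ∫ x', u x' z ∂ν :=
    hm.stronglyMeasurable.integral_prod_left.measurable
  have hmeanint : Integrable (fun z => ∫ x', u x' z ∂ν) μ := hu.integral_prod_right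
  have hdiff : Measurable fun p : X × Z => ‖u p.1 p.2 - ∫ x', u x' p.2 ∂ν‖ₑ :=
    (hm.sub (hmean.comp measurable_snd)).enorm
  have hg : Integrable (fun x => ∫ z, u x z ∂μ) ν := hu.integral_prod_left
  calc ENNReal.ofReal (∫ x, |(∫ z, u x z ∂μ) - ∫ x', (∫ z, u x' z ∂μ) ∂ν| ∂ν)
      = ∫⁻ x, ‖(∫ z, u x z ∂μ) - ∫ x', (∫ z, u x' z ∂μ) ∂ν‖ₑ ∂ν :=
        ofReal_integral_norm_eq_lintegral_enorm (hg.sub (integrable_const _))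
    _ ≤ ∫⁻ x, ∫⁻ z, ‖u x z - ∫ x', u x' z ∂ν‖ₑ ∂μ ∂ν := by
        refine lintegral_mono_ae ?_
        filter_upwards [hu.prod_right_ae] with x hx
        have hx' : Integrable (fun z => u x z) μ := hx
        rw [integral_integral_swap hu, ← integral_sub hx' hmeanint]
        exact enorm_integral_le_lintegral_enorm _
    _ = ∫⁻ z, ∫⁻ x, ‖u x z - ∫ x', u x' z ∂ν‖ₑ ∂ν ∂μ :=
        lintegral_lintegral_swap hdiff.aemeasurable
    _ = ∫⁻ z, ENNReal.ofReal (∫ x, |u x z - ∫ x', u x' z ∂ν| ∂ν) ∂μ := by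
        refine lintegral_congr_ae ?_
        filter_upwards [hu.prod_left_ae] with z hz
        exact (ofReal_integral_norm_eq_lintegral_enorm (hz.sub (integrable_const _))).symm

section Translate

variable {E : Type*} [NormedAddCommGroup E] [MeasureSpace E] [BorelSpace E]
  [(volume : Measure E).IsAddHaarMeasure]

lemma volume_preimage_add (Q : Set E) (z : E) :
    volume ((fun y => y + z) ⁻¹' Q) = volume Q :=
  measure_preimage_add_right volume z Q

lemma setIntegral_preimage_add (h : E → ℝ) (Q : Set E) (z : E) :
    ∫ y in (fun y => y + z) ⁻¹' Q, h y = ∫ x in Q, h (x - z) := by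
  simpa using (measurePreserving_add_right volume z).setIntegral_preimage_emb
    (Homeomorph.addRight z).measurableEmbedding (fun x => h (x - z)) Q

lemma setAverage_preimage_add (h : E → ℝ) (Q : Set E) (z : E) :
    ⨍ y in (fun y => y + z) ⁻¹' Q, h y = ⨍ x in Q, h (x - z) := by
  rw [setAverage_eq, setAverage_eq, setIntegral_preimage_add, measureReal_def,
    volume_preimage_add, measureReal_def]

lemma meanOsc_preimage_add (f : E → ℝ) (Q : Set E) (z : E) :
    meanOsc f ((fun y => y + z) ⁻¹' Q) = meanOsc (fun x => f (x - z)) Q := by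
  rw [meanOsc, setAverage_preimage_add, setAverage_preimage_add, meanOsc]

lemma setLIntegral_enorm_preimage_add {f : E → ℝ} (hf : Measurable f) {Q : Set E}
    (hQ : MeasurableSet Q) (z : E) :
    ∫⁻ y in (fun y => y + z) ⁻¹' Q, ‖f y‖ₑ = ∫⁻ x in Q, ‖f (x - z)‖ₑ := by
  rw [← (measurePreserving_add_right volume z).setLIntegral_comp_preimage hQ
    (f := fun x => ‖f (x - z)‖ₑ) (hf.comp (measurable_id.sub_const z)).enorm]
  simp

lemma measurable_ofReal_meanOsc_preimage_add [ProperSpace E] {f : E → ℝ} (hf : Measurable f) (Q : Set E) :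
    Measurable fun z => ENNReal.ofReal (meanOsc f ((fun y => y + z) ⁻¹' Q)) := by
  simp_rw [fun z => meanOsc_preimage_add f Q z]
  simp only [meanOsc, setAverage_eq, smul_eq_mul]
  have h₁ : Measurable (Function.uncurry fun (x z : E) => f (x - z)) :=
    hf.comp (measurable_fst.sub measurable_snd)
  have h₂ : Measurable fun z => ∫ x in Q, f (x - z) :=
    h₁.stronglyMeasurable.integral_prod_left.measurable
  have h₃ : Measurable (Function.uncurry fun (x z : E) =>
      |f (x - z) - (volume.real Q)⁻¹ * ∫ y in Q, f (y - z)|) :=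
    (h₁.sub ((h₂.comp measurable_snd).const_mul _)).norm
  exact (h₃.stronglyMeasurable.integral_prod_left.measurable.const_mul _).ennreal_ofReal

/-- The mean oscillation of an average of translates is at most the average of the mean
oscillations over the translated sets. -/
lemma ofReal_meanOsc_integral_translate_le [ProperSpace E] {f : E → ℝ} (hf : Measurable f) {Q : Set E}
    (hQ : MeasurableSet Q) (hQ₀ : volume Q ≠ 0) (hQ₁ : volume Q ≠ ⊤)
    (μ : Measure E) [IsProbabilityMeasure μ] {C : ℝ≥0∞} (hC : C ≠ ⊤)
    (hbd : ∀ᵐ z ∂μ, ∫⁻ y in (fun y => y + z) ⁻¹' Q, ‖f y‖ₑ ≤ C) :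
    ENNReal.ofReal (meanOsc (fun x => ∫ z, f (x - z) ∂μ) Q) ≤
      ∫⁻ z, ENNReal.ofReal (meanOsc f ((fun y => y + z) ⁻¹' Q)) ∂μ := by
  have hprob : IsProbabilityMeasure ((volume Q)⁻¹ • volume.restrict Q) :=
    ⟨by simp [ENNReal.inv_mul_cancel hQ₀ hQ₁]⟩
  have hm : Measurable (Function.uncurry fun (x z : E) => f (x - z)) :=
    hf.comp (measurable_fst.sub measurable_snd)
  have hint : Integrable (Function.uncurry fun (x z : E) => f (x - z))
      (((volume Q)⁻¹ • volume.restrict Q).prod μ) := by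
    refine ⟨hm.aestronglyMeasurable, ?_⟩
    rw [HasFiniteIntegral, lintegral_prod_symm _ hm.enorm.aemeasurable]
    refine lt_of_le_of_lt (lintegral_mono_ae (g := fun _ => (volume Q)⁻¹ * C) ?_) ?_
    · filter_upwards [hbd] with z hz
      rw [lintegral_smul_measure, smul_eq_mul]
      rw [setLIntegral_enorm_preimage_add hf hQ] at hz
      exact mul_le_mul_right hz _
    · rw [lintegral_const, measure_univ, mul_one]
      exact ENNReal.mul_lt_top (ENNReal.inv_lt_top.2 (pos_iff_ne_zero.2 hQ₀)) hC.lt_top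
  simp_rw [fun z => meanOsc_preimage_add f Q z]
  simp only [meanOsc, setAverage_eq']
  exact ofReal_integral_abs_integral_sub_le _ μ _ hm hint

/-- If the mean oscillations of `f` over the translates of `Q` by a bounded set of vectors are
bounded, then so are the integrals of `|f|`. -/
lemma exists_setLIntegral_preimage_add_le {f : E → ℝ} (hf : Measurable f) {Q : Set E}
    (hQ : IsOpen Q) (hQne : Q.Nonempty) (hQ₁ : volume Q ≠ ⊤) {s t : Set E} (hst : s ⊆ t)
    (ht : IsCompact t) (hint : ∀ z ∈ s, IntegrableOn f ((fun y => y + z) ⁻¹' Q))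
    {S : ℝ≥0∞} (hS : S ≠ ⊤)
    (hosc : ∀ z ∈ s, ENNReal.ofReal (meanOsc f ((fun y => y + z) ⁻¹' Q)) ≤ S) :
    ∃ C : ℝ≥0∞, C ≠ ⊤ ∧ ∀ z ∈ s, ∫⁻ y in (fun y => y + z) ⁻¹' Q, ‖f y‖ₑ ≤ C := by
  suffices H : ∃ C : ℝ≥0∞, C ≠ ⊤ ∧ ∀ z ∈ t, z ∈ s →
      ∫⁻ y in (fun y => y + z) ⁻¹' Q, ‖f y‖ₑ ≤ C by
    obtain ⟨C, hC, h⟩ := H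
    exact ⟨C, hC, fun z hz => h z (hst hz) hz⟩
  have hQ₀ : volume Q ≠ 0 := (hQ.measure_pos volume hQne).ne'
  refine ht.induction_on (p := fun t => ∃ C : ℝ≥0∞, C ≠ ⊤ ∧ ∀ z ∈ t, z ∈ s →
    ∫⁻ y in (fun y => y + z) ⁻¹' Q, ‖f y‖ₑ ≤ C) ⟨0, by simp, by simp⟩ ?_ ?_ ?_
  · rintro a b hab ⟨C, hC, h⟩
    exact ⟨C, hC, fun z hz => h z (hab hz)⟩
  · rintro a b ⟨C, hC, h⟩ ⟨D, hD, h'⟩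
    refine ⟨max C D, by simp [hC, hD], ?_⟩
    rintro z (hz | hz) hzs
    · exact (h z hz hzs).trans (le_max_left _ _)
    · exact (h' z hz hzs).trans (le_max_right _ _)
  · intro z₀ _
    obtain ⟨q, hq⟩ := hQne
    obtain ⟨r, hr, hball⟩ := Metric.isOpen_iff.1 hQ q hq
    refine ⟨ball z₀ (r / 2), mem_nhdsWithin_of_mem_nhds (ball_mem_nhds _ (half_pos hr)), ?_⟩
    set B : Set E := ball (q - z₀) (r / 2)
    have hB : ∀ z ∈ ball z₀ (r / 2), B ⊆ (fun y => y + z) ⁻¹' Q := by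
      intro z hz y hy
      apply hball
      have hsum : y + z - q = (y - (q - z₀)) + (z - z₀) := by abel
      rw [mem_ball, dist_eq_norm] at hy hz ⊢
      rw [hsum]
      linarith [norm_add_le (y - (q - z₀)) (z - z₀)]
    have hB₀ : volume B ≠ 0 := (measure_ball_pos _ _ (half_pos hr)).ne'
    by_cases hne : ∃ z₁ ∈ ball z₀ (r / 2), z₁ ∈ s
    · obtain ⟨z₁, hz₁, hz₁s⟩ := hne
      set A := ∫⁻ y in B, ‖f y‖ₑ
      have hA : A ≠ ⊤ := ((hint z₁ hz₁s).mono_set (hB z₁ hz₁)).2.ne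
      have hB₁ : volume B ≠ ⊤ := ne_top_of_le_ne_top hQ₁
        ((measure_mono (hB z₁ hz₁)).trans (volume_preimage_add Q z₁).le)
      refine ⟨volume Q * S + (volume Q * S + A) / volume B * volume Q, ?_, ?_⟩
      · have h₁ : volume Q * S ≠ ⊤ := ENNReal.mul_ne_top hQ₁ hS
        exact ENNReal.add_ne_top.2 ⟨h₁, ENNReal.mul_ne_top
          (ENNReal.div_ne_top (ENNReal.add_ne_top.2 ⟨h₁, hA⟩) hB₀) hQ₁⟩
      · intro z hz hzs
        set m := ⨍ y in (fun y => y + z) ⁻¹' Q, f y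
        have hdev : ∫⁻ y in (fun y => y + z) ⁻¹' Q, ‖f y - m‖ₑ ≤ volume Q * S := by
          rw [setLIntegral_enorm_sub_setAverage (by rwa [volume_preimage_add])
            (by rwa [volume_preimage_add]) (hint z hzs), volume_preimage_add]
          exact mul_le_mul_right (hosc z hzs) _
        have hmean : ‖m‖ₑ ≤ (volume Q * S + A) / volume B := by
          rw [ENNReal.le_div_iff_mul_le (.inl hB₀) (.inl hB₁)]
          calc ‖m‖ₑ * volume B = ∫⁻ _ in B, ‖m‖ₑ := (setLIntegral_const _ _).symm
            _ ≤ ∫⁻ y in B, (‖f y - m‖ₑ + ‖f y‖ₑ) := lintegral_mono fun y => by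
                rw [← enorm_neg (f y - m)]
                simpa using enorm_add_le (-(f y - m)) (f y)
            _ = (∫⁻ y in B, ‖f y - m‖ₑ) + A := lintegral_add_right _ hf.enorm
            _ ≤ volume Q * S + A := by
                gcongr
                exact (lintegral_mono_set (hB z hz)).trans hdev
        calc ∫⁻ y in (fun y => y + z) ⁻¹' Q, ‖f y‖ₑ
            ≤ ∫⁻ y in (fun y => y + z) ⁻¹' Q, (‖f y - m‖ₑ + ‖m‖ₑ) :=
              lintegral_mono fun y => by simpa using enorm_add_le (f y - m) m
          _ = (∫⁻ y in (fun y => y + z) ⁻¹' Q, ‖f y - m‖ₑ) + ‖m‖ₑ * volume Q := by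
              rw [lintegral_add_right _ measurable_const, setLIntegral_const,
                volume_preimage_add]
          _ ≤ _ := by gcongr
    · exact ⟨0, by simp, fun z hz hzs => absurd ⟨z, hz, hzs⟩ hne⟩

end Translate

lemma kappa_eq (n : ℕ) (ε : ℝ) (f : EuclideanSpace ℝ (Fin n) → ℝ)
    (Ω : Set (EuclideanSpace ℝ (Fin n))) :
    kappa n ε f Ω = ENNReal.ofReal (ε ^ (n - 1)) *
      ⨆ (F : Set (Set (EuclideanSpace ℝ (Fin n))))
        (_ : ∀ Q ∈ F, IsCube n ε Q ∧ Q ⊆ Ω) (_ : F.Pairwise Disjoint),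
        ∑' Q : F, ENNReal.ofReal (meanOsc f (Q : Set (EuclideanSpace ℝ (Fin n)))) := rfl

lemma IsCube.isOpen {n : ℕ} {ε : ℝ} {Q : Set (EuclideanSpace ℝ (Fin n))} (hQ : IsCube n ε Q) :
    IsOpen Q := by
  obtain ⟨T, x, rfl⟩ := hQ
  refine (T.toHomeomorph.trans (Homeomorph.addLeft x)).isOpenMap _ ?_
  simp only [Set.ofPred_forall]
  exact isOpen_iInter_of_finite fun i => isOpen_lt (by fun_prop) continuous_const

lemma IsCube.nonempty {n : ℕ} {ε : ℝ} (hε : 0 < ε) {Q : Set (EuclideanSpace ℝ (Fin n))}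
    (hQ : IsCube n ε Q) : Q.Nonempty := by
  obtain ⟨T, x, rfl⟩ := hQ
  exact ⟨_, 0, by simp [hε], rfl⟩

lemma IsCube.preimage_add {n : ℕ} {ε : ℝ} {Q : Set (EuclideanSpace ℝ (Fin n))}
    (hQ : IsCube n ε Q) (z : EuclideanSpace ℝ (Fin n)) :
    IsCube n ε ((fun y => y + z) ⁻¹' Q) := by
  obtain ⟨T, x, rfl⟩ := hQ
  refine ⟨T, x - z, ?_⟩
  ext y
  simp only [Set.mem_preimage, Set.mem_image]
  refine exists_congr fun w => and_congr_right fun _ => ?_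
  rw [← sub_eq_iff_eq_add]
  constructor <;> rintro rfl <;> abel

lemma meanOsc_congr_ae {n : ℕ} {f g : EuclideanSpace ℝ (Fin n) → ℝ}
    {Ω Q : Set (EuclideanSpace ℝ (Fin n))} (hfg : f =ᵐ[volume.restrict Ω] g) (hQ : Q ⊆ Ω) :
    meanOsc f Q = meanOsc g Q := by
  have h : f =ᵐ[volume.restrict Q] g := ae_restrict_of_ae_restrict_of_subset hQ hfg
  have h' : ⨍ y in Q, f y = ⨍ y in Q, g y := average_congr h
  rw [meanOsc, meanOsc, h']
  exact average_congr (h.mono fun x hx => by simp only [hx])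

lemma kappa_congr_ae {n : ℕ} {ε : ℝ} {f g : EuclideanSpace ℝ (Fin n) → ℝ}
    {Ω : Set (EuclideanSpace ℝ (Fin n))} (hfg : f =ᵐ[volume.restrict Ω] g) :
    kappa n ε f Ω = kappa n ε g Ω := by
  rw [kappa_eq, kappa_eq]
  congr 1
  refine iSup_congr fun F => iSup_congr fun hF => iSup_congr fun _ => tsum_congr fun Q => ?_
  rw [meanOsc_congr_ae hfg (hF Q Q.2).2]

/-- Averaging translates by vectors of length less than `δ` does not increase `kappa`. -/
lemma kappa_integral_translate_le {n : ℕ} {Ω Ω' : Set (EuclideanSpace ℝ (Fin n))}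
    (hΩ'cpt : IsCompact (closure Ω'))
    {f : EuclideanSpace ℝ (Fin n) → ℝ} (hfm : Measurable f)
    (hf : LocallyIntegrableOn f Ω volume) {ε δ : ℝ} (hε : 0 < ε)
    (hdist : ∀ x ∈ Ω', ∀ y, y ∉ Ω → δ < dist x y)
    (μ : Measure (EuclideanSpace ℝ (Fin n))) [IsProbabilityMeasure μ]
    (hμ : ∀ᵐ z ∂μ, z ∈ ball 0 δ) :
    kappa n ε (fun x => ∫ z, f (x - z) ∂μ) Ω' ≤ kappa n ε f Ω := by
  rw [kappa_eq, kappa_eq]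
  refine mul_le_mul_right (iSup_le fun F => iSup_le fun hF => iSup_le fun hdisj => ?_) _
  set S := ⨆ (F : Set (Set (EuclideanSpace ℝ (Fin n))))
    (_ : ∀ Q ∈ F, IsCube n ε Q ∧ Q ⊆ Ω) (_ : F.Pairwise Disjoint),
    ∑' Q : F, ENNReal.ofReal (meanOsc f (Q : Set (EuclideanSpace ℝ (Fin n))))
  obtain hS | hS := eq_or_ne S ⊤
  · rw [hS]; exact le_top
  have hleS : ∀ F : Set (Set (EuclideanSpace ℝ (Fin n))),
      (∀ Q ∈ F, IsCube n ε Q ∧ Q ⊆ Ω) → F.Pairwise Disjoint →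
      ∑' Q : F, ENNReal.ofReal (meanOsc f (Q : Set (EuclideanSpace ℝ (Fin n)))) ≤ S :=
    fun F h₁ h₂ => le_iSup_of_le F (le_iSup_of_le h₁ (le_iSup_of_le h₂ le_rfl))
  have hclosure : ∀ z ∈ ball (0 : EuclideanSpace ℝ (Fin n)) δ,
      (fun y => y + z) ⁻¹' closure Ω' ⊆ Ω := by
    intro z hz y hy
    by_contra hyΩ
    have hle : closure Ω' ⊆ {x | δ ≤ dist x y} :=
      closure_minimal (fun x hx => (hdist x hx y hyΩ).le)
        (isClosed_le continuous_const (by fun_prop))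
    have h := hle hy
    rw [mem_ball_zero_iff] at hz
    simp only [Set.mem_ofPred_eq, dist_eq_norm, add_sub_cancel_left] at h
    exact hz.not_ge h
  have hsub : ∀ z ∈ ball (0 : EuclideanSpace ℝ (Fin n)) δ, ∀ Q ∈ F,
      (fun y => y + z) ⁻¹' Q ⊆ Ω := fun z hz Q hQ =>
    (Set.preimage_mono ((hF Q hQ).2.trans subset_closure)).trans (hclosure z hz)
  have hsum : ∀ z ∈ ball (0 : EuclideanSpace ℝ (Fin n)) δ,
      ∑' Q : F, ENNReal.ofReal (meanOsc f ((fun y => y + z) ⁻¹' (Q : Set _))) ≤ S := by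
    intro z hz
    have hinj : Function.Injective fun Q : Set (EuclideanSpace ℝ (Fin n)) =>
        (fun y => y + z) ⁻¹' Q :=
      (Homeomorph.addRight z).surjective.preimage_injective
    have hle := hleS ((fun Q => (fun y => y + z) ⁻¹' Q) '' F) ?_ ?_
    · rwa [tsum_image (fun Q => ENNReal.ofReal (meanOsc f Q)) hinj.injOn] at hle
    · rintro _ ⟨Q, hQ, rfl⟩
      exact ⟨(hF Q hQ).1.preimage_add z, hsub z hz Q hQ⟩
    · rintro _ ⟨Q, hQ, rfl⟩ _ ⟨R, hR, rfl⟩ hne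
      exact (hdisj hQ hR fun h => hne (by rw [h])).preimage _
  have hone : ∀ Q ∈ F, ENNReal.ofReal (meanOsc (fun x => ∫ z, f (x - z) ∂μ) Q) ≤
      ∫⁻ z, ENNReal.ofReal (meanOsc f ((fun y => y + z) ⁻¹' Q)) ∂μ := by
    intro Q hQ
    have hopen := (hF Q hQ).1.isOpen
    have hne := (hF Q hQ).1.nonempty hε
    have hfin : volume Q ≠ ⊤ := ne_top_of_le_ne_top hΩ'cpt.measure_lt_top.ne
      (measure_mono ((hF Q hQ).2.trans subset_closure))
    obtain ⟨C, hC, hbd⟩ := exists_setLIntegral_preimage_add_le hfm hopen hne hfin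
      ball_subset_closedBall (isCompact_closedBall (0 : EuclideanSpace ℝ (Fin n)) δ)
      (fun z hz => (hf.integrableOn_compact_subset (hclosure z hz)
        ((Homeomorph.addRight z).isCompact_preimage.2 hΩ'cpt)).mono_set
          (Set.preimage_mono ((hF Q hQ).2.trans subset_closure))) hS
      (fun z hz => (ENNReal.le_tsum (⟨Q, hQ⟩ : F)).trans (hsum z hz))
    exact ofReal_meanOsc_integral_translate_le hfm hopen.measurableSet
      (hopen.measure_pos volume hne).ne' hfin μ hC (hμ.mono hbd)
  have hcount : F.Countable := Set.PairwiseDisjoint.countable_of_isOpen (s := id) hdisj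
    (fun Q hQ => (hF Q hQ).1.isOpen) (fun Q hQ => (hF Q hQ).1.nonempty hε)
  have : Countable F := hcount.to_subtype
  have hmeas : ∀ Q : F, AEMeasurable
      (fun z => ENNReal.ofReal (meanOsc f ((fun y => y + z) ⁻¹' Q.1))) μ :=
    fun Q => (measurable_ofReal_meanOsc_preimage_add hfm Q.1).aemeasurable
  refine (ENNReal.tsum_le_tsum fun Q : F => hone Q Q.2).trans ?_
  rw [← lintegral_tsum hmeas]
  refine (lintegral_mono_ae (g := fun _ => S) (hμ.mono hsum)).trans ?_
  rw [lintegral_const, measure_univ, mul_one]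

/-- The rescaled mollifier is a probability density. -/
lemma isProbabilityMeasure_withDensity_mollifier {n : ℕ} {δ : ℝ} (hδ : 0 < δ)
    {ρ : EuclideanSpace ℝ (Fin n) → ℝ} (hρnonneg : ∀ x, 0 ≤ ρ x) (hρint : ∫ x, ρ x = 1) :
    IsProbabilityMeasure
      (volume.withDensity fun z => ENNReal.ofReal ((δ ^ n)⁻¹ * ρ (δ⁻¹ • z))) := by
  have hpos : 0 < δ ^ n := pow_pos hδ n
  have hone : ∫ z, (δ ^ n)⁻¹ * ρ (δ⁻¹ • z) = 1 := by
    rw [integral_const_mul, Measure.integral_comp_inv_smul, hρint]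
    simp [abs_of_pos hpos, hpos.ne']
  refine ⟨?_⟩
  rw [withDensity_apply _ MeasurableSet.univ, Measure.restrict_univ,
    ← ofReal_integral_eq_lintegral_ofReal, hone, ENNReal.ofReal_one]
  · exact Integrable.of_integral_ne_zero (by simp [hone])
  · exact Filter.Eventually.of_forall fun z =>
      mul_nonneg (inv_nonneg.2 hpos.le) (hρnonneg _)

/-- A continuous function with support in the closed unit ball vanishes off the open one. -/
lemma eq_zero_of_one_le_norm {n : ℕ} {ρ : EuclideanSpace ℝ (Fin n) → ℝ}
    (hρ : Continuous ρ) (hρsupp : tsupport ρ ⊆ Metric.closedBall 0 1)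
    {x : EuclideanSpace ℝ (Fin n)} (hx : 1 ≤ ‖x‖) : ρ x = 0 := by
  by_contra hne
  have hopen : IsOpen (Function.support ρ) := hρ.isOpen_support
  have hint : x ∈ interior (Metric.closedBall (0 : EuclideanSpace ℝ (Fin n)) 1) :=
    interior_maximal ((subset_tsupport ρ).trans hρsupp) hopen hne
  rw [interior_closedBall _ one_ne_zero, mem_ball_zero_iff] at hint
  exact hint.not_ge hx

/-- Mollification does not increase the BMO-type functional:
`κ_ε(ρ_δ * f, Ω') ≤ κ_ε(f, Ω)` when `Ω' ⋐ Ω` and `dist(Ω', ℝⁿ \ Ω) > δ`. -/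
theorem kappa_mollification_le
    (n : ℕ) (hn : 1 ≤ n)
    (Ω Ω' : Set (EuclideanSpace ℝ (Fin n))) (hΩ : IsOpen Ω) (hΩ' : IsOpen Ω')
    (hΩ'cpt : IsCompact (closure Ω')) (hΩ'sub : closure Ω' ⊆ Ω)
    (f : EuclideanSpace ℝ (Fin n) → ℝ) (hf : LocallyIntegrableOn f Ω volume)
    (ε δ : ℝ) (hε : 0 < ε) (hδ : 0 < δ)
    (hdist : ∀ x ∈ Ω', ∀ y, y ∉ Ω → δ < dist x y)
    (ρ : EuclideanSpace ℝ (Fin n) → ℝ)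
    (hρsmooth : ContDiff ℝ (⊤ : ℕ∞) ρ) (hρnonneg : ∀ x, 0 ≤ ρ x)
    (hρsupp : tsupport ρ ⊆ Metric.closedBall 0 1) (hρint : ∫ x, ρ x = 1) :
    kappa n ε (fun x => ∫ y in Ω, (δ ^ n)⁻¹ * ρ (δ⁻¹ • (x - y)) * f y) Ω' ≤
      kappa n ε f Ω := by
  have hδn : 0 < δ ^ n := pow_pos hδ n
  set f' : EuclideanSpace ℝ (Fin n) → ℝ := Ω.indicator (hf.aestronglyMeasurable.mk f)
  have hff' : f =ᵐ[volume.restrict Ω] f' :=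
    hf.aestronglyMeasurable.ae_eq_mk.trans (indicator_ae_eq_restrict hΩ.measurableSet).symm
  have hf'm : Measurable f' :=
    hf.aestronglyMeasurable.stronglyMeasurable_mk.measurable.indicator hΩ.measurableSet
  have hf' : LocallyIntegrableOn f' Ω volume := by
    rw [locallyIntegrableOn_iff hΩ.isLocallyClosed] at hf ⊢
    intro k hk hkc
    exact (hf k hk hkc).congr (ae_restrict_of_ae_restrict_of_subset hk hff')
  set μ := volume.withDensity fun z => ENNReal.ofReal ((δ ^ n)⁻¹ * ρ (δ⁻¹ • z)) with hμdef
  have hprob : IsProbabilityMeasure μ :=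
    isProbabilityMeasure_withDensity_mollifier hδ hρnonneg hρint
  have hρm : Measurable fun z => ENNReal.ofReal ((δ ^ n)⁻¹ * ρ (δ⁻¹ • z)) :=
    ((hρsmooth.continuous.comp (continuous_const_smul _)).measurable.const_mul _).ennreal_ofReal
  have hμ : ∀ᵐ z ∂μ, z ∈ ball 0 δ := by
    rw [hμdef, ae_withDensity_iff hρm]
    refine Filter.Eventually.of_forall fun z hz => ?_
    by_contra hzball
    rw [mem_ball_zero_iff, not_lt] at hzball
    apply hz
    rw [eq_zero_of_one_le_norm hρsmooth.continuous hρsupp, mul_zero, ENNReal.ofReal_zero]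
    rw [norm_smul, norm_inv, Real.norm_of_nonneg hδ.le, inv_mul_eq_div]
    exact (one_le_div hδ).2 hzball
  have hconv : (fun x => ∫ y in Ω, (δ ^ n)⁻¹ * ρ (δ⁻¹ • (x - y)) * f y) =
      fun x => ∫ z, f' (x - z) ∂μ := by
    funext x
    rw [hμdef, integral_withDensity_eq_integral_toReal_smul hρm (by simp)]
    have hnonneg : ∀ z, 0 ≤ (δ ^ n)⁻¹ * ρ (δ⁻¹ • z) := fun z =>
      mul_nonneg (inv_nonneg.2 hδn.le) (hρnonneg _)
    simp only [ENNReal.toReal_ofReal (hnonneg _), smul_eq_mul]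
    rw [← integral_sub_left_eq_self _ volume x]
    simp only [sub_sub_cancel]
    rw [← setIntegral_eq_integral_of_forall_compl_eq_zero (s := Ω)
      (f := fun y => (δ ^ n)⁻¹ * ρ (δ⁻¹ • (x - y)) * f' y)]
    · exact integral_congr_ae (hff'.mono fun y hy => by simp only [hy])
    · intro y hy
      simp [f', Set.indicator_of_notMem hy]
  rw [hconv, kappa_congr_ae hff']
  exact kappa_integral_translate_le hΩ'cpt hf'm hf' hε hdist μ hμ

end
end

section
/- Let n ≥ 1, let Ω ⊂ ℝ^n be open, and let f ∈ L^1_loc(Ω). Then for every family {f_ε}_{ε>0} with f_ε → f in L^1_loc(Ω) as ε → 0, one has (1/4)·Var(f, Ω) ≤ liminf_{ε→0} κ_ε(f_ε, Ω). In particular, if the right-hand side is finite then f has finite variation in Ω. -/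
open MeasureTheory Filter Topology Metric
open scoped ENNReal RealInnerProductSpace Classical

noncomputable section

section StandardCube

variable {n : ℕ}

/-- The open cube of side length `ε` centred at the origin with sides parallel to the axes. -/
def stdCube (n : ℕ) (ε : ℝ) : Set (EuclideanSpace ℝ (Fin n)) :=
  {y | ∀ i, |y i| < ε / 2}

lemma isOpen_stdCube (ε : ℝ) : IsOpen (stdCube n ε) := by
  simp only [stdCube, Set.ofPred_forall]
  exact isOpen_iInter_of_finite fun i => isOpen_lt (by fun_prop) continuous_const

lemma norm_le_of_forall_abs_le {ε : ℝ} (hε : 0 ≤ ε) {y : EuclideanSpace ℝ (Fin n)}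
    (hy : ∀ i, |y i| ≤ ε) : ‖y‖ ≤ n * ε := by
  rw [EuclideanSpace.norm_eq, Real.sqrt_le_left (by positivity)]
  calc ∑ i, ‖y i‖ ^ 2 ≤ ∑ _i : Fin n, ε ^ 2 :=
        Finset.sum_le_sum fun i _ => pow_le_pow_left₀ (norm_nonneg _) (hy i) 2
    _ = n * ε ^ 2 := by simp
    _ ≤ (n * ε) ^ 2 := by
        rw [mul_pow]
        gcongr
        exact_mod_cast Nat.le_self_pow two_ne_zero n

lemma norm_le_of_mem_stdCube {ε : ℝ} (hε : 0 ≤ ε) {y : EuclideanSpace ℝ (Fin n)}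
    (hy : y ∈ stdCube n ε) : ‖y‖ ≤ n * ε :=
  norm_le_of_forall_abs_le hε fun i => (hy i).le.trans (by linarith)

lemma volume_stdCube (ε : ℝ) : volume (stdCube n ε) = ENNReal.ofReal ε ^ n := by
  have h : stdCube n ε = (@WithLp.ofLp 2 (Fin n → ℝ)) ⁻¹'
      (Set.univ.pi fun _ => Set.Ioo (-(ε / 2)) (ε / 2)) := by
    ext y
    simp [stdCube, abs_lt, Set.mem_pi]
  rw [h, (PiLp.volume_preserving_ofLp (Fin n)).measure_preimage
    (MeasurableSet.univ_pi fun _ => measurableSet_Ioo).nullMeasurableSet, volume_pi_pi]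
  simp

lemma volume_closedCube (ε : ℝ) :
    volume {y : EuclideanSpace ℝ (Fin n) | ∀ i, |y i| ≤ ε / 2} = ENNReal.ofReal ε ^ n := by
  have h : {y : EuclideanSpace ℝ (Fin n) | ∀ i, |y i| ≤ ε / 2} =
      (@WithLp.ofLp 2 (Fin n → ℝ)) ⁻¹' (Set.univ.pi fun _ => Set.Icc (-(ε / 2)) (ε / 2)) := by
    ext y
    simp [abs_le, Pi.le_def, forall_and]
  rw [h, (PiLp.volume_preserving_ofLp (Fin n)).measure_preimage
    (MeasurableSet.univ_pi fun _ => measurableSet_Icc).nullMeasurableSet, volume_pi_pi]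
  simp

lemma setIntegral_abs_Ioo {ε : ℝ} (hε : 0 ≤ ε) :
    ∫ t in Set.Ioo (-(ε / 2)) (ε / 2), |t| = ε ^ 2 / 4 := by
  rw [← integral_Ioc_eq_integral_Ioo, ← intervalIntegral.integral_of_le (by linarith),
    ← intervalIntegral.integral_add_adjacent_intervals (b := 0)
      (continuous_abs.intervalIntegrable _ _) (continuous_abs.intervalIntegrable _ _)]
  have h1 : ∫ t in (-(ε / 2))..0, |t| = ∫ t in (-(ε / 2))..0, -t :=
    intervalIntegral.integral_congr fun t ht => by
      rw [Set.uIcc_of_le (by linarith)] at ht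
      exact abs_of_nonpos ht.2
  have h2 : ∫ t in (0 : ℝ)..(ε / 2), |t| = ∫ t in (0 : ℝ)..(ε / 2), t :=
    intervalIntegral.integral_congr fun t ht => by
      rw [Set.uIcc_of_le (by linarith)] at ht
      exact abs_of_nonneg ht.1
  rw [h1, h2, intervalIntegral.integral_neg, integral_id, integral_id]
  ring

lemma setIntegral_abs_stdCube {ε : ℝ} (hε : 0 ≤ ε) (i₀ : Fin n) :
    ∫ y in stdCube n ε, |y i₀| = ε ^ (n + 1) / 4 := by
  set I := Set.Ioo (-(ε / 2)) (ε / 2)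
  let g : Fin n → ℝ → ℝ := fun i => I.indicator (if i = i₀ then fun t => |t| else fun _ => 1)
  have key : ∀ y : EuclideanSpace ℝ (Fin n),
      (stdCube n ε).indicator (fun y => |y i₀|) y = ∏ i, g i (y i) := by
    intro y
    by_cases hy : y ∈ stdCube n ε
    · rw [Set.indicator_of_mem hy]
      have : ∀ i, g i (y i) = if i = i₀ then |y i₀| else 1 := by
        intro i
        have hi : y i ∈ I := abs_lt.1 (hy i)
        simp only [g, Set.indicator_of_mem hi]
        split_ifs with h <;> simp [h]
      simp [this]
    · rw [Set.indicator_of_notMem hy]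
      simp only [stdCube, Set.mem_ofPred_eq, not_forall] at hy
      obtain ⟨i, hi⟩ := hy
      have hI : y i ∉ I := fun h => hi (abs_lt.2 h)
      have hgi : g i (y i) = 0 := by simp [g, hI]
      exact (Finset.prod_eq_zero (Finset.mem_univ i) hgi).symm
  rw [← integral_indicator (isOpen_stdCube ε).measurableSet, integral_congr_ae (ae_of_all _ key)]
  have := (PiLp.volume_preserving_ofLp (Fin n)).integral_comp
    (MeasurableEquiv.toLp 2 (Fin n → ℝ)).symm.measurableEmbedding (fun z => ∏ i, g i (z i))
  rw [this, integral_fintype_prod_volume_eq_prod]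
  have hg : ∀ i, ∫ t, g i t = ε * (if i = i₀ then ε / 4 else 1) := by
    intro i
    simp only [g]
    rw [integral_indicator measurableSet_Ioo]
    split_ifs with h
    · rw [setIntegral_abs_Ioo hε]; ring
    · simp [hε]
  simp only [hg, Finset.prod_mul_distrib, Finset.prod_ite_eq', Finset.mem_univ, if_true,
    Finset.prod_const, Finset.card_univ, Fintype.card_fin]
  ring

end StandardCube

section RotatedCube

variable {n : ℕ}

lemma measurable_realSign : Measurable Real.sign :=
  Measurable.ite measurableSet_Iio measurable_const
    (Measurable.ite measurableSet_Ioi measurable_const measurable_const)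

lemma abs_realSign_le_one (t : ℝ) : |Real.sign t| ≤ 1 := by
  rcases Real.sign_apply_eq t with h | h | h <;> simp [h]

lemma self_mul_realSign (t : ℝ) : t * Real.sign t = |t| := by
  rcases lt_trichotomy t 0 with h | h | h
  · rw [Real.sign_of_neg h, abs_of_neg h, mul_neg_one]
  · simp [h]
  · rw [Real.sign_of_pos h, abs_of_pos h, mul_one]

lemma measurePreserving_add_isometry
    (T : EuclideanSpace ℝ (Fin n) ≃ₗᵢ[ℝ] EuclideanSpace ℝ (Fin n))
    (c : EuclideanSpace ℝ (Fin n)) :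
    MeasurePreserving (fun y => c + T y) volume volume :=
  (measurePreserving_add_left volume c).comp T.measurePreserving

lemma measurableEmbedding_add_isometry
    (T : EuclideanSpace ℝ (Fin n) ≃ₗᵢ[ℝ] EuclideanSpace ℝ (Fin n))
    (c : EuclideanSpace ℝ (Fin n)) :
    MeasurableEmbedding (fun y => c + T y) :=
  (measurableEmbedding_addLeft c).comp T.toMeasurableEquiv.measurableEmbedding

/-- The open cube centred at `c` of side length `ε` whose sides are parallel to the image of the
coordinate axes under `T`. -/
def rotCube (ε : ℝ) (T : EuclideanSpace ℝ (Fin n) ≃ₗᵢ[ℝ] EuclideanSpace ℝ (Fin n))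
    (c : EuclideanSpace ℝ (Fin n)) : Set (EuclideanSpace ℝ (Fin n)) :=
  (fun y => c + T y) '' stdCube n ε

variable {ε : ℝ} {T : EuclideanSpace ℝ (Fin n) ≃ₗᵢ[ℝ] EuclideanSpace ℝ (Fin n)}
  {c : EuclideanSpace ℝ (Fin n)}

lemma isCube_rotCube : IsCube n ε (rotCube ε T c) := ⟨T, c, rfl⟩

lemma mem_rotCube {p : EuclideanSpace ℝ (Fin n)} :
    p ∈ rotCube ε T c ↔ T.symm (p - c) ∈ stdCube n ε := by
  constructor
  · rintro ⟨y, hy, rfl⟩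
    simpa using hy
  · exact fun h => ⟨_, h, by simp⟩

lemma dist_le_of_mem_rotCube (hε : 0 ≤ ε) {p : EuclideanSpace ℝ (Fin n)}
    (hp : p ∈ rotCube ε T c) : dist p c ≤ n * ε := by
  rw [dist_eq_norm, ← T.symm.norm_map]
  exact norm_le_of_mem_stdCube hε (mem_rotCube.1 hp)

lemma volume_rotCube : volume (rotCube ε T c) = ENNReal.ofReal ε ^ n := by
  rw [← volume_stdCube, rotCube, (measurePreserving_add_isometry T c).measure_preimage_emb
    (measurableEmbedding_add_isometry T c) _ |>.symm,
    Set.preimage_image_eq _ (measurableEmbedding_add_isometry T c).injective]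

lemma setIntegral_rotCube (φ : EuclideanSpace ℝ (Fin n) → ℝ) :
    ∫ p in rotCube ε T c, φ p = ∫ y in stdCube n ε, φ (c + T y) :=
  (measurePreserving_add_isometry T c).setIntegral_image_emb
    (measurableEmbedding_add_isometry T c) φ _

lemma setAverage_rotCube (hε : 0 ≤ ε) (φ : EuclideanSpace ℝ (Fin n) → ℝ) :
    ⨍ p in rotCube ε T c, φ p = (∫ y in stdCube n ε, φ (c + T y)) / ε ^ n := by
  rw [setAverage_eq, measureReal_def, volume_rotCube, setIntegral_rotCube, ENNReal.toReal_pow,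
    ENNReal.toReal_ofReal hε, smul_eq_mul, inv_mul_eq_div]

lemma integrableOn_stdCube_comp {u : EuclideanSpace ℝ (Fin n) → ℝ}
    (hu : IntegrableOn u (rotCube ε T c)) :
    IntegrableOn (fun y => u (c + T y)) (stdCube n ε) :=
  ((measurePreserving_add_isometry T c).integrableOn_image
    (measurableEmbedding_add_isometry T c)).1 hu

lemma integrableOn_mul_realSign {s : Set (EuclideanSpace ℝ (Fin n))}
    {u : EuclideanSpace ℝ (Fin n) → ℝ} (hu : IntegrableOn u s) (i₀ : Fin n) :
    IntegrableOn (fun y => u y * Real.sign (y i₀)) s :=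
  Integrable.mul_bdd (c := 1) hu
    (measurable_realSign.comp (by fun_prop)).aestronglyMeasurable
    (ae_of_all _ fun _ => abs_realSign_le_one _)

lemma setIntegral_realSign_stdCube (i₀ : Fin n) :
    ∫ y in stdCube n ε, Real.sign (y i₀) = 0 := by
  have h : ∫ y in stdCube n ε, Real.sign (y i₀) = - ∫ y in stdCube n ε, Real.sign (y i₀) := by
    conv_lhs => rw [← integral_indicator (isOpen_stdCube ε).measurableSet, ← integral_neg_eq_self]
    rw [← integral_neg, ← integral_indicator (isOpen_stdCube ε).measurableSet]
    congr 1
    ext y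
    have hy : -y ∈ stdCube n ε ↔ y ∈ stdCube n ε := by simp [stdCube]
    by_cases h : y ∈ stdCube n ε
    · simp [Set.indicator, h, hy, Real.sign_neg]
    · simp [Set.indicator, h, hy]
  linarith

/-- The integral of `u` over a rotated cube against the sign of the coordinate `i₀`. -/
def signIntegral (ε : ℝ) (i₀ : Fin n)
    (T : EuclideanSpace ℝ (Fin n) ≃ₗᵢ[ℝ] EuclideanSpace ℝ (Fin n))
    (c : EuclideanSpace ℝ (Fin n)) (u : EuclideanSpace ℝ (Fin n) → ℝ) : ℝ :=
  ∫ y in stdCube n ε, u (c + T y) * Real.sign (y i₀)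

lemma signIntegral_div_le_average (hε : 0 ≤ ε) (i₀ : Fin n)
    {u : EuclideanSpace ℝ (Fin n) → ℝ} (hu : IntegrableOn u (rotCube ε T c)) :
    signIntegral ε i₀ T c u / ε ^ n ≤
      ⨍ x in rotCube ε T c, |u x - ⨍ y in rotCube ε T c, u y| := by
  rw [setAverage_rotCube hε (fun x => |u x - _|)]
  set a := ⨍ y in rotCube ε T c, u y
  have hfin : volume (stdCube n ε) ≠ ⊤ := by
    rw [volume_stdCube]; exact ENNReal.pow_ne_top ENNReal.ofReal_ne_top
  have hu' := integrableOn_stdCube_comp hu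
  have hsub : IntegrableOn (fun y => u (c + T y) - a) (stdCube n ε) :=
    hu'.sub (integrableOn_const hfin)
  have ha : IntegrableOn (fun y : EuclideanSpace ℝ (Fin n) => a * Real.sign (y i₀))
      (stdCube n ε) := integrableOn_mul_realSign (integrableOn_const (C := a) hfin) i₀
  have h0 : signIntegral ε i₀ T c u =
      ∫ y in stdCube n ε, (u (c + T y) - a) * Real.sign (y i₀) := by
    simp only [sub_mul]
    rw [integral_sub (integrableOn_mul_realSign hu' i₀) ha, integral_const_mul,
      setIntegral_realSign_stdCube]
    simp [signIntegral]
  rw [h0]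
  refine div_le_div_of_nonneg_right ?_ (by positivity)
  refine integral_mono (integrableOn_mul_realSign hsub i₀) hsub.abs fun y => ?_
  calc (u (c + T y) - a) * Real.sign (y i₀) ≤ |u (c + T y) - a| * |Real.sign (y i₀)| := by
        rw [← abs_mul]; exact le_abs_self _
    _ ≤ |u (c + T y) - a| := mul_le_of_le_one_right (abs_nonneg _) (abs_realSign_le_one _)

lemma le_signIntegral (hε : 0 ≤ ε) (i₀ : Fin n) {w : EuclideanSpace ℝ (Fin n)}
    (hT : T (EuclideanSpace.single i₀ ‖w‖) = w) {ω : ℝ} (hω : 0 ≤ ω)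
    {u : EuclideanSpace ℝ (Fin n) → ℝ} (hu : IntegrableOn u (rotCube ε T c))
    (hlin : ∀ p ∈ rotCube ε T c, |u p - u c - ⟪w, p - c⟫| ≤ ω * ‖p - c‖) :
    ε ^ (n + 1) * (‖w‖ / 4 - n * ω) ≤ signIntegral ε i₀ T c u := by
  have hinner : ∀ y, ⟪w, T y⟫ = ‖w‖ * y i₀ := fun y => by
    conv_lhs => rw [← hT]
    rw [T.inner_map_map, EuclideanSpace.inner_single_left]
    simp
  have hfin : volume (stdCube n ε) ≠ ⊤ := by
    rw [volume_stdCube]; exact ENNReal.pow_ne_top ENNReal.ofReal_ne_top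
  have habs : IntegrableOn (fun y : EuclideanSpace ℝ (Fin n) => |y i₀|) (stdCube n ε) :=
    Measure.integrableOn_of_bounded (M := ε) hfin (by fun_prop)
      ((ae_restrict_iff' (isOpen_stdCube ε).measurableSet).2 (ae_of_all _ fun y hy => by
        simpa using (hy i₀).le.trans (by linarith)))
  have hsgn : IntegrableOn (fun y : EuclideanSpace ℝ (Fin n) => u c * Real.sign (y i₀))
      (stdCube n ε) := integrableOn_mul_realSign (integrableOn_const (C := u c) hfin) i₀
  have hconst : IntegrableOn (fun _ : EuclideanSpace ℝ (Fin n) => ω * (n * ε)) (stdCube n ε) :=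
    integrableOn_const hfin
  have hsum : IntegrableOn (fun y : EuclideanSpace ℝ (Fin n) =>
      u c * Real.sign (y i₀) + ‖w‖ * |y i₀|) (stdCube n ε) := hsgn.add (habs.const_mul _)
  calc ε ^ (n + 1) * (‖w‖ / 4 - n * ω)
      = ∫ y in stdCube n ε, (u c * Real.sign (y i₀) + ‖w‖ * |y i₀| - ω * (n * ε)) := by
        rw [integral_sub hsum hconst,
          integral_add hsgn (habs.const_mul _), integral_const_mul, integral_const_mul,
          setIntegral_realSign_stdCube, setIntegral_abs_stdCube hε, setIntegral_const,
          measureReal_def, volume_stdCube, ENNReal.toReal_pow, ENNReal.toReal_ofReal hε,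
          smul_eq_mul]
        ring
    _ ≤ signIntegral ε i₀ T c u := by
        refine setIntegral_mono_on (hsum.sub hconst)
          (integrableOn_mul_realSign (integrableOn_stdCube_comp hu) i₀)
          (isOpen_stdCube ε).measurableSet fun y hy => ?_
        have h1 := hlin (c + T y) ⟨y, hy, rfl⟩
        simp only [add_sub_cancel_left, hinner, T.norm_map] at h1
        set r := u (c + T y) - u c - ‖w‖ * y i₀ with hr
        have h2 : |r * Real.sign (y i₀)| ≤ ω * (n * ε) := by
          rw [abs_mul]
          calc |r| * |Real.sign (y i₀)| ≤ |r| :=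
                mul_le_of_le_one_right (abs_nonneg _) (abs_realSign_le_one _)
            _ ≤ ω * ‖y‖ := h1
            _ ≤ ω * (n * ε) := by gcongr; exact norm_le_of_mem_stdCube hε hy
        have h3 := (abs_le.1 h2).1
        have h4 : u (c + T y) * Real.sign (y i₀) =
            u c * Real.sign (y i₀) + ‖w‖ * |y i₀| + r * Real.sign (y i₀) := by
          rw [← self_mul_realSign, hr]; ring
        simp only [h4]
        linarith

lemma exists_isometry_single (i₀ : Fin n) (w : EuclideanSpace ℝ (Fin n)) :
    ∃ T : EuclideanSpace ℝ (Fin n) ≃ₗᵢ[ℝ] EuclideanSpace ℝ (Fin n),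
      T (EuclideanSpace.single i₀ ‖w‖) = w :=
  ⟨_, Submodule.reflection_sub (by simp)⟩

end RotatedCube

section Packing

variable {n : ℕ}

lemma finite_image_round {α : Type*} {C : Set α} {φ : α → EuclideanSpace ℝ (Fin n)} {R : ℝ}
    (hR : ∀ p ∈ C, ‖φ p‖ ≤ R) {ε : ℝ} (hε : 0 < ε) :
    ((fun p i => round (φ p i / ε)) '' C : Set (Fin n → ℤ)).Finite := by
  set M : ℤ := ⌈R / ε⌉ + 1
  refine (Set.finite_Icc (fun _ => -M : Fin n → ℤ) (fun _ => M)).subset ?_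
  rintro _ ⟨p, hp, rfl⟩
  have key : ∀ i, |(round (φ p i / ε) : ℝ)| ≤ M := fun i => by
    have h1 := abs_sub_round (φ p i / ε)
    have h2 : |φ p i / ε| ≤ R / ε := by
      rw [abs_div, abs_of_pos hε]
      gcongr
      exact (PiLp.norm_apply_le (φ p) i).trans (hR p hp)
    have h3 : R / ε ≤ ⌈R / ε⌉ := Int.le_ceil _
    have h4 : ((M : ℤ) : ℝ) = ⌈R / ε⌉ + 1 := by simp [M]
    rw [h4]
    rw [abs_le] at *
    constructor <;> linarith
  refine ⟨fun i => ?_, fun i => ?_⟩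
  · exact_mod_cast (abs_le.1 (key i)).1
  · exact_mod_cast (abs_le.1 (key i)).2

lemma abs_sub_mul_round_le {ε : ℝ} (hε : 0 < ε) (t : ℝ) :
    |t - ε * round (t / ε)| ≤ ε / 2 := by
  have h := abs_sub_round (t / ε)
  have : t - ε * round (t / ε) = ε * (t / ε - round (t / ε)) := by field_simp
  rw [this, abs_mul, abs_of_pos hε]
  nlinarith

/-- The point of the lattice `ε ℤⁿ` with index `k`. -/
def latticePoint (ε : ℝ) (k : Fin n → ℤ) : EuclideanSpace ℝ (Fin n) :=
  WithLp.toLp 2 fun i => ε * k i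

/-- A compact set can be covered, up to taking closures, by finitely many disjoint cubes of side
length `ε` with a prescribed orientation, each of them close to the set; only the resulting count
of the cubes is recorded. -/
lemma exists_disjoint_rotCubes (T : EuclideanSpace ℝ (Fin n) ≃ₗᵢ[ℝ] EuclideanSpace ℝ (Fin n))
    {C : Set (EuclideanSpace ℝ (Fin n))} (hC : IsCompact C) {ε : ℝ} (hε : 0 < ε) (b : ℝ) :
    ∃ S : Finset (EuclideanSpace ℝ (Fin n)),
      (S : Set (EuclideanSpace ℝ (Fin n))).PairwiseDisjoint (rotCube ε T) ∧
      (∀ c ∈ S, ∃ p ∈ C, dist p c ≤ n * ε) ∧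
      volume.real C * b ≤ S.card * ε ^ n * b := by
  rcases lt_or_ge b 0 with hb | hb
  · exact ⟨∅, by simp, by simp, by
      simpa using mul_nonpos_of_nonneg_of_nonpos measureReal_nonneg hb.le⟩
  obtain ⟨R, hR⟩ := hC.isBounded.exists_norm_le
  let idx : EuclideanSpace ℝ (Fin n) → Fin n → ℤ := fun p i => round (T.symm p i / ε)
  have hfin : (idx '' C).Finite :=
    finite_image_round (φ := T.symm) (R := R) (fun p hp => by simpa using hR p hp) hε
  let cen : (Fin n → ℤ) → EuclideanSpace ℝ (Fin n) := fun k => T (latticePoint ε k)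
  have hclose : ∀ p i, |T.symm (p - cen (idx p)) i| ≤ ε / 2 := fun p i => by
    simpa [cen, idx, latticePoint] using abs_sub_mul_round_le hε (T.symm p i)
  refine ⟨hfin.toFinset.image cen, ?_, ?_, ?_⟩
  · rintro _ hc _ hd hne
    simp only [Finset.coe_image, Set.mem_image] at hc hd
    obtain ⟨k, -, rfl⟩ := hc
    obtain ⟨l, -, rfl⟩ := hd
    refine Set.disjoint_left.2 fun p hp hq => hne ?_
    have : k = l := by
      ext i
      have h1 := mem_rotCube.1 hp i
      have h2 := mem_rotCube.1 hq i
      simp only [cen, latticePoint, map_sub, LinearIsometryEquiv.symm_apply_apply,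
        PiLp.sub_apply] at h1 h2
      have h3 : |ε * (k i - l i : ℝ)| < ε * 1 := by
        rw [abs_lt] at *
        constructor <;> linarith
      rw [abs_mul, abs_of_pos hε] at h3
      have h4 : |(k i - l i : ℝ)| < 1 := lt_of_mul_lt_mul_left h3 hε.le
      have h5 : |k i - l i| < 1 := by exact_mod_cast h4
      exact sub_eq_zero.1 (Int.abs_lt_one_iff.1 h5)
    rw [this]
  · intro c hc
    simp only [Finset.mem_image, Set.Finite.mem_toFinset, Set.mem_image] at hc
    obtain ⟨_, ⟨p, hp, rfl⟩, rfl⟩ := hc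
    refine ⟨p, hp, ?_⟩
    rw [dist_eq_norm, ← T.symm.norm_map]
    exact norm_le_of_forall_abs_le hε.le fun i => (hclose p i).trans (by linarith)
  · gcongr
    set S := hfin.toFinset.image cen
    have hcov : C ⊆ ⋃ c ∈ S, (fun y => c + T y) '' {y | ∀ i, |y i| ≤ ε / 2} := by
      intro p hp
      simp only [Set.mem_iUnion]
      refine ⟨cen (idx p), Finset.mem_image_of_mem _ (hfin.mem_toFinset.2 ⟨p, hp, rfl⟩),
        T.symm (p - cen (idx p)), hclose p, by simp⟩
    have hvol : ∀ c, volume ((fun y => c + T y) '' {y | ∀ i, |y i| ≤ ε / 2}) =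
        ENNReal.ofReal ε ^ n := fun c => by
      rw [← volume_closedCube, ← (measurePreserving_add_isometry T c).measure_preimage_emb
        (measurableEmbedding_add_isometry T c),
        Set.preimage_image_eq _ (measurableEmbedding_add_isometry T c).injective]
    have hle : volume C ≤ S.card * ENNReal.ofReal ε ^ n := by
      refine (measure_mono hcov).trans ((measure_biUnion_finset_le _ _).trans ?_)
      simp [hvol]
    have := ENNReal.toReal_mono (by finiteness) hle
    simpa [measureReal_def, ENNReal.toReal_ofReal hε.le] using this

/-- A continuous vector field on a compact set is nearly constant on finitely many disjoint compact
pieces which carry almost all of its `L¹` norm. -/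
lemma exists_nearly_constant_pieces {G : EuclideanSpace ℝ (Fin n) → EuclideanSpace ℝ (Fin n)}
    (hG : Continuous G) {K : Set (EuclideanSpace ℝ (Fin n))} (hK : IsCompact K) {η : ℝ}
    (hη : 0 < η) :
    ∃ (J : Finset (Fin n → ℤ)) (C : (Fin n → ℤ) → Set (EuclideanSpace ℝ (Fin n)))
      (w : (Fin n → ℤ) → EuclideanSpace ℝ (Fin n)),
      (∀ j, IsCompact (C j)) ∧ (∀ j, C j ⊆ K) ∧ (∀ i j, i ≠ j → Disjoint (C i) (C j)) ∧
      (∀ j, ∀ x ∈ C j, ‖G x - w j‖ ≤ η) ∧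
      ∫ x in K, ‖G x‖ ≤ ∑ j ∈ J, volume.real (C j) * ‖w j‖ + η := by
  obtain ⟨σ, hσ, hσ1, hσ2⟩ : ∃ σ > 0, n * σ ≤ η ∧ volume.real K * (n * σ) ≤ η / 2 := by
    have hV : 0 ≤ volume.real K := measureReal_nonneg
    refine ⟨η / (2 * (n + 1) * (1 + volume.real K)), by positivity, ?_, ?_⟩
    · rw [mul_div_assoc', div_le_iff₀ (by positivity)]
      nlinarith [mul_nonneg (Nat.cast_nonneg (α := ℝ) n) hV, mul_nonneg hη.le hV,
        mul_nonneg (mul_nonneg (Nat.cast_nonneg (α := ℝ) n) hV) hη.le,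
        mul_nonneg (Nat.cast_nonneg (α := ℝ) n) hη.le]
    · rw [mul_div_assoc', mul_div_assoc', div_le_div_iff₀ (by positivity) (by positivity)]
      nlinarith [mul_nonneg (Nat.cast_nonneg (α := ℝ) n) hV, mul_nonneg hη.le hV,
        mul_nonneg (mul_nonneg (Nat.cast_nonneg (α := ℝ) n) hV) hη.le,
        mul_nonneg (Nat.cast_nonneg (α := ℝ) n) hη.le]
  let idx : EuclideanSpace ℝ (Fin n) → Fin n → ℤ := fun x i => round (G x i / σ)
  let w : (Fin n → ℤ) → EuclideanSpace ℝ (Fin n) := latticePoint σ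
  let B : (Fin n → ℤ) → Set (EuclideanSpace ℝ (Fin n)) := fun m => K ∩ idx ⁻¹' {m}
  obtain ⟨R, hR⟩ := (hK.image hG).isBounded.exists_norm_le
  have hfin : (idx '' K).Finite :=
    finite_image_round (φ := G) (R := R) (fun p hp => hR _ ⟨p, hp, rfl⟩) hσ
  set J := hfin.toFinset
  have hidx : Measurable idx := measurable_pi_lambda _ fun i => by
    have : Measurable fun x => ⌊G x i / σ + 1 / 2⌋ := by
      have hc : Continuous fun x => G x i := by fun_prop
      exact Int.measurable_floor.comp ((hc.measurable.div_const _).add_const _)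
    simpa only [idx, round_eq] using this
  have hBm : ∀ m, MeasurableSet (B m) := fun m =>
    hK.measurableSet.inter (hidx (measurableSet_singleton m))
  have hBfin : ∀ m, volume (B m) ≠ ⊤ := fun m =>
    ((measure_mono Set.inter_subset_left).trans_lt hK.measure_lt_top).ne
  have hBdisj : ∀ i j, i ≠ j → Disjoint (B i) (B j) := fun i j hij =>
    Set.disjoint_left.2 fun x hi hj => hij (hi.2.symm.trans hj.2)
  have hBK : ⋃ m ∈ J, B m = K := by
    ext x
    simp only [Set.mem_iUnion]
    exact ⟨fun ⟨m, _, hx⟩ => hx.1, fun hx => ⟨idx x, hfin.mem_toFinset.2 ⟨x, hx, rfl⟩, hx, rfl⟩⟩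
  have hBw : ∀ m, ∀ x ∈ B m, ‖G x - w m‖ ≤ n * σ := by
    rintro m x ⟨-, rfl⟩
    refine norm_le_of_forall_abs_le hσ.le fun i => ?_
    have := abs_sub_mul_round_le hσ (G x i)
    simp only [w, idx, latticePoint, PiLp.sub_apply]
    linarith
  obtain ⟨τ, hτ, hτ'⟩ : ∃ τ > 0, τ * ∑ m ∈ J, ‖w m‖ ≤ η / 2 := by
    have hW : 0 ≤ ∑ m ∈ J, ‖w m‖ := Finset.sum_nonneg fun _ _ => norm_nonneg _
    refine ⟨η / (2 * (1 + ∑ m ∈ J, ‖w m‖)), by positivity, ?_⟩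
    rw [div_mul_eq_mul_div, div_le_div_iff₀ (by positivity) (by positivity)]
    nlinarith
  choose C hCB hCc hCv using fun m => (hBm m).exists_isCompact_lt_add (hBfin m)
    (ENNReal.ofReal_pos.2 hτ).ne'
  have hCv' : ∀ m, volume.real (B m) ≤ volume.real (C m) + τ := fun m => by
    have := ENNReal.toReal_mono (by have := (hCc m).measure_lt_top (μ := volume); finiteness)
      (hCv m).le
    rwa [ENNReal.toReal_add (hCc m).measure_lt_top.ne ENNReal.ofReal_ne_top,
      ENNReal.toReal_ofReal hτ.le] at this
  have hGint : ∀ m, IntegrableOn (fun x => ‖G x‖) (B m) := fun m =>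
    (hG.norm.continuousOn.integrableOn_compact hK).mono_set Set.inter_subset_left
  refine ⟨J, C, w, hCc, fun j => (hCB j).trans Set.inter_subset_left,
    fun i j hij => (hBdisj i j hij).mono (hCB i) (hCB j),
    fun j x hx => (hBw j x (hCB j hx)).trans hσ1, ?_⟩
  calc ∫ x in K, ‖G x‖ = ∑ m ∈ J, ∫ x in B m, ‖G x‖ := by
        rw [← integral_biUnion_finset J (fun m _ => hBm m)
          (fun i _ j _ hij => hBdisj i j hij) (fun m _ => hGint m), hBK]
    _ ≤ ∑ m ∈ J, volume.real (B m) * (‖w m‖ + n * σ) := by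
        refine Finset.sum_le_sum fun m _ => ?_
        rw [← smul_eq_mul, ← setIntegral_const]
        refine setIntegral_mono_on (hGint m) (integrableOn_const (hBfin m)) (hBm m) fun x hx => ?_
        have h1 := hBw m x hx
        have h2 := norm_sub_norm_le (G x) (w m)
        linarith
    _ = ∑ m ∈ J, volume.real (B m) * ‖w m‖ + volume.real K * (n * σ) := by
        rw [← hBK, measureReal_biUnion_finset (fun i _ j _ hij => hBdisj i j hij)
          (fun m _ => hBm m) (fun m _ => hBfin m), Finset.sum_mul, ← Finset.sum_add_distrib]
        exact Finset.sum_congr rfl fun m _ => by ring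
    _ ≤ ∑ m ∈ J, (volume.real (C m) + τ) * ‖w m‖ + η / 2 := by
        gcongr with m
        exact hCv' m
    _ = ∑ m ∈ J, volume.real (C m) * ‖w m‖ + τ * ∑ m ∈ J, ‖w m‖ + η / 2 := by
        rw [Finset.mul_sum, ← Finset.sum_add_distrib]
        simp only [add_mul]
    _ ≤ ∑ m ∈ J, volume.real (C m) * ‖w m‖ + η := by linarith

end Packing

section Kappa

variable {n : ℕ}

lemma sum_average_le_kappa {ι : Type*} {ε : ℝ} {f : EuclideanSpace ℝ (Fin n) → ℝ}
    {Ω : Set (EuclideanSpace ℝ (Fin n))} (I : Finset ι) (Q : ι → Set (EuclideanSpace ℝ (Fin n)))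
    (hcube : ∀ i ∈ I, IsCube n ε (Q i)) (hsub : ∀ i ∈ I, Q i ⊆ Ω)
    (hne : ∀ i ∈ I, (Q i).Nonempty) (hdisj : (I : Set ι).PairwiseDisjoint Q) :
    ENNReal.ofReal (ε ^ (n - 1)) *
      ∑ i ∈ I, ENNReal.ofReal (⨍ x in Q i, |f x - ⨍ y in Q i, f y|) ≤ kappa n ε f Ω := by
  have hinj : Set.InjOn Q I := fun i hi j hj hij => by
    by_contra hne'
    have := hdisj hi hj hne'
    rw [Function.onFun, ← hij, disjoint_self] at this
    exact (hne i hi).ne_empty this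
  unfold kappa
  gcongr
  refine le_iSup_of_le (Q '' I) (le_iSup_of_le ?_ (le_iSup_of_le ?_ ?_))
  · rintro _ ⟨i, hi, rfl⟩
    exact ⟨hcube i hi, hsub i hi⟩
  · rintro _ ⟨i, hi, rfl⟩ _ ⟨j, hj, rfl⟩ hij
    exact hdisj hi hj fun h => hij (by rw [h])
  · rw [tsum_image (fun Q : Set (EuclideanSpace ℝ (Fin n)) =>
      ENNReal.ofReal (⨍ x in Q, |f x - ⨍ y in Q, f y|)) hinj, Finset.tsum_subtype' I
      (fun i => ENNReal.ofReal (⨍ x in Q i, |f x - ⨍ y in Q i, f y|))]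

lemma sum_signIntegral_le {ι : Type*} (hn : 1 ≤ n) {ε : ℝ} (hε : 0 < ε)
    {u : EuclideanSpace ℝ (Fin n) → ℝ} {Ω : Set (EuclideanSpace ℝ (Fin n))} (i₀ : Fin n)
    (I : Finset ι) (T : ι → EuclideanSpace ℝ (Fin n) ≃ₗᵢ[ℝ] EuclideanSpace ℝ (Fin n))
    (c : ι → EuclideanSpace ℝ (Fin n)) (hsub : ∀ i ∈ I, rotCube ε (T i) (c i) ⊆ Ω)
    (hdisj : (I : Set ι).PairwiseDisjoint fun i => rotCube ε (T i) (c i))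
    (hint : ∀ i ∈ I, IntegrableOn u (rotCube ε (T i) (c i)))
    (hfin : kappa n ε u Ω ≠ ⊤) :
    ∑ i ∈ I, signIntegral ε i₀ (T i) (c i) u ≤ ε * (kappa n ε u Ω).toReal := by
  have h := sum_average_le_kappa (f := u) I (fun i => rotCube ε (T i) (c i))
    (fun i _ => isCube_rotCube) hsub
    (fun i _ => ⟨c i, mem_rotCube.2 fun j => by simpa using hε⟩) hdisj
  have h0 : ∀ i, 0 ≤ ⨍ x in rotCube ε (T i) (c i),
      |u x - ⨍ y in rotCube ε (T i) (c i), u y| := fun i => by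
    rw [setAverage_eq]
    exact smul_nonneg (by positivity) (integral_nonneg fun _ => abs_nonneg _)
  have h1 := ENNReal.toReal_mono hfin h
  rw [← ENNReal.ofReal_sum_of_nonneg fun i _ => h0 i, ← ENNReal.ofReal_mul (by positivity),
    ENNReal.toReal_ofReal (mul_nonneg (by positivity) (Finset.sum_nonneg fun i _ => h0 i))] at h1
  have hpow : ε ^ n = ε * ε ^ (n - 1) := by
    rw [← pow_succ', Nat.sub_add_cancel hn]
  calc ∑ i ∈ I, signIntegral ε i₀ (T i) (c i) u
      = ε ^ n * ∑ i ∈ I, signIntegral ε i₀ (T i) (c i) u / ε ^ n := by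
        rw [← Finset.sum_div]
        field_simp
    _ ≤ ε ^ n * ∑ i ∈ I, ⨍ x in rotCube ε (T i) (c i),
          |u x - ⨍ y in rotCube ε (T i) (c i), u y| := by
        gcongr with i hi
        exact signIntegral_div_le_average hε.le i₀ (hint i hi)
    _ = ε * (ε ^ (n - 1) * ∑ i ∈ I, ⨍ x in rotCube ε (T i) (c i),
          |u x - ⨍ y in rotCube ε (T i) (c i), u y|) := by
        rw [hpow]; ring
    _ ≤ ε * (kappa n ε u Ω).toReal := by gcongr

end Kappa

section Mollification

open scoped Convolution

variable {n : ℕ} (φ : ContDiffBump (0 : EuclideanSpace ℝ (Fin n)))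

/-- The convolution of `u` with the normalized bump function `φ`. -/
def mollify (u : EuclideanSpace ℝ (Fin n) → ℝ) : EuclideanSpace ℝ (Fin n) → ℝ :=
  φ.normed volume ⋆[ContinuousLinearMap.lsmul ℝ ℝ, volume] u

variable {u : EuclideanSpace ℝ (Fin n) → ℝ}

lemma mollify_apply (x : EuclideanSpace ℝ (Fin n)) :
    mollify φ u x = ∫ z, φ.normed volume z * u (x - z) := rfl

lemma mollify_apply_swap (x : EuclideanSpace ℝ (Fin n)) :
    mollify φ u x = ∫ t, φ.normed volume (x - t) * u t :=
  convolution_eq_swap _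

lemma contDiff_mollify (hu : Integrable u) : ContDiff ℝ 1 (mollify φ u) :=
  φ.hasCompactSupport_normed.contDiff_convolution_left _ φ.contDiff_normed hu.locallyIntegrable

lemma hasCompactSupport_mollify (hu : HasCompactSupport u) : HasCompactSupport (mollify φ u) :=
  φ.hasCompactSupport_normed.convolution _ hu

lemma integrable_normed_sub_mul (hu : Integrable u) (x : EuclideanSpace ℝ (Fin n)) :
    Integrable fun t => φ.normed volume (x - t) * u t := by
  obtain ⟨M, hM⟩ := (φ.continuous_normed (μ := volume)).bounded_above_of_compact_support
    φ.hasCompactSupport_normed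
  exact hu.bdd_mul (c := M)
    (φ.continuous_normed.comp (continuous_const.sub continuous_id)).aestronglyMeasurable
    (ae_of_all _ fun t => hM _)

lemma mollify_sub {v : EuclideanSpace ℝ (Fin n) → ℝ} (hu : Integrable u) (hv : Integrable v)
    (x : EuclideanSpace ℝ (Fin n)) :
    mollify φ (fun t => u t - v t) x = mollify φ u x - mollify φ v x := by
  simp only [mollify_apply_swap, mul_sub]
  exact integral_sub (integrable_normed_sub_mul φ hu x) (integrable_normed_sub_mul φ hv x)

lemma exists_lipschitz_mollify :
    ∃ L : ℝ, 0 ≤ L ∧ ∀ u : EuclideanSpace ℝ (Fin n) → ℝ, Integrable u → ∀ x y,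
      |mollify φ u x - mollify φ u y| ≤ L * (∫ t, |u t|) * ‖x - y‖ := by
  obtain ⟨L, hL⟩ := ContDiff.lipschitzWith_of_hasCompactSupport
    (φ.hasCompactSupport_normed (μ := volume)) (φ.contDiff_normed (n := 1)) one_ne_zero
  refine ⟨L, L.2, fun u hu x y => ?_⟩
  rw [mollify_apply_swap, mollify_apply_swap, ← integral_sub (integrable_normed_sub_mul φ hu x)
    (integrable_normed_sub_mul φ hu y), ← Real.norm_eq_abs]
  calc _ ≤ ∫ t, L * ‖x - y‖ * |u t| :=
        norm_integral_le_of_norm_le (hu.abs.const_mul _) (ae_of_all _ fun t => by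
          rw [← sub_mul, norm_mul, Real.norm_eq_abs (u t)]
          gcongr
          simpa [dist_eq_norm] using hL.dist_le_mul (x - t) (y - t))
    _ = L * (∫ t, |u t|) * ‖x - y‖ := by
        rw [integral_const_mul]; ring

lemma integral_mollify_mul (hu : Integrable u) {k : EuclideanSpace ℝ (Fin n) → ℝ}
    (hk : AEStronglyMeasurable k volume) {M : ℝ} (hM : ∀ x, |k x| ≤ M) :
    Integrable (fun z => φ.normed volume z * ∫ x, u (x - z) * k x) ∧
      ∫ x, mollify φ u x * k x = ∫ z, φ.normed volume z * ∫ x, u (x - z) * k x := by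
  have hint : Integrable (fun p : EuclideanSpace ℝ (Fin n) × EuclideanSpace ℝ (Fin n) =>
      φ.normed volume p.2 * u (p.1 - p.2) * k p.1) (volume.prod volume) :=
    Integrable.mul_bdd (c := M) (φ.integrable_normed.convolution_integrand
      (ContinuousLinearMap.lsmul ℝ ℝ) hu) hk.comp_fst (ae_of_all _ fun p => hM _)
  constructor
  · refine hint.integral_prod_right.congr (ae_of_all _ fun z => ?_)
    simp only [mul_assoc, integral_const_mul]
  · simp only [mollify_apply, ← integral_mul_const]
    rw [integral_integral_swap hint]
    simp only [mul_assoc, integral_const_mul]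

lemma abs_integral_mul_sub_integral_mollify_mul_le (hu : Integrable u)
    {ψ : EuclideanSpace ℝ (Fin n) → ℝ} (hψ : Continuous ψ) (hψc : HasCompactSupport ψ)
    {η : ℝ} (hη : ∀ x z, ‖z‖ < φ.rOut → |ψ (x + z) - ψ x| ≤ η) :
    |(∫ x, mollify φ u x * ψ x) - ∫ x, u x * ψ x| ≤ η * ∫ x, |u x| := by
  obtain ⟨M, hM⟩ := hψ.bounded_above_of_compact_support hψc
  obtain ⟨hi, he⟩ := integral_mollify_mul φ hu hψ.aestronglyMeasurable hM
  have hshift : ∀ z, Integrable fun x => u x * ψ (x + z) := fun z =>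
    hu.mul_bdd (c := M) (by fun_prop) (ae_of_all _ fun x => hM _)
  have h1 : ∫ x, u x * ψ x = ∫ z, φ.normed volume z * ∫ x, u x * ψ x := by
    rw [integral_mul_const, φ.integral_normed, one_mul]
  rw [he, h1, ← integral_sub hi (φ.integrable_normed.mul_const _), ← Real.norm_eq_abs]
  refine (norm_integral_le_of_norm_le (φ.integrable_normed.mul_const (η * ∫ x, |u x|))
    (ae_of_all _ fun z => ?_)).trans ?_
  · rw [← mul_sub, norm_mul, Real.norm_of_nonneg (φ.nonneg_normed z)]
    by_cases hz : ‖z‖ < φ.rOut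
    · refine mul_le_mul_of_nonneg_left ?_ (φ.nonneg_normed z)
      have h2 : ∫ x, u (x - z) * ψ x = ∫ x, u x * ψ (x + z) := by
        rw [← integral_add_right_eq_self _ z]
        simp
      have h3 := hshift 0
      simp only [add_zero] at h3
      rw [h2, ← integral_sub (hshift z) h3, ← integral_const_mul]
      refine norm_integral_le_of_norm_le (hu.abs.const_mul _) (ae_of_all _ fun x => ?_)
      rw [← mul_sub, norm_mul, mul_comm, Real.norm_eq_abs, Real.norm_eq_abs]
      gcongr
      exact hη x z hz
    · have : φ.normed volume z = 0 := by
        rw [← Function.notMem_support, φ.support_normed_eq]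
        simpa using hz
      simp [this]
  · rw [integral_mul_const, φ.integral_normed, one_mul]

end Mollification

section SignIntegralMollify

variable {n : ℕ} {ε : ℝ} {T : EuclideanSpace ℝ (Fin n) ≃ₗᵢ[ℝ] EuclideanSpace ℝ (Fin n)}
  {c : EuclideanSpace ℝ (Fin n)} (φ : ContDiffBump (0 : EuclideanSpace ℝ (Fin n)))

lemma signIntegral_mollify (i₀ : Fin n) {u : EuclideanSpace ℝ (Fin n) → ℝ} (hu : Integrable u) :
    Integrable (fun z => φ.normed volume z * signIntegral ε i₀ T (c - z) u) ∧
      signIntegral ε i₀ T c (mollify φ u) =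
        ∫ z, φ.normed volume z * signIntegral ε i₀ T (c - z) u := by
  have hQ : MeasurableSet (rotCube ε T c) :=
    (measurableEmbedding_add_isometry T c).measurableSet_image.2 (isOpen_stdCube ε).measurableSet
  set k : EuclideanSpace ℝ (Fin n) → ℝ :=
    (rotCube ε T c).indicator fun x => Real.sign (T.symm (x - c) i₀)
  have hk : Measurable k := (measurable_realSign.comp (by fun_prop)).indicator hQ
  have hk1 : ∀ x, |k x| ≤ 1 := fun x => by
    by_cases hx : x ∈ rotCube ε T c
    · simpa [k, hx] using abs_realSign_le_one _
    · simp [k, hx]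
  have hsign : ∀ v : EuclideanSpace ℝ (Fin n) → ℝ,
      ∫ x, v x * k x = signIntegral ε i₀ T c v := fun v => by
    simp only [k, ← Set.indicator_mul_right]
    rw [integral_indicator hQ, setIntegral_rotCube]
    simp [signIntegral]
  have hshift : ∀ z, ∫ x, u (x - z) * k x = signIntegral ε i₀ T (c - z) u := fun z => by
    rw [hsign fun x => u (x - z)]
    simp only [signIntegral, sub_add_eq_add_sub]
  have h := integral_mollify_mul φ hu hk.aestronglyMeasurable hk1
  simpa only [hshift, hsign] using h

lemma signIntegral_congr (i₀ : Fin n) {u v : EuclideanSpace ℝ (Fin n) → ℝ}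
    (h : ∀ x ∈ rotCube ε T c, u x = v x) :
    signIntegral ε i₀ T c u = signIntegral ε i₀ T c v :=
  setIntegral_congr_fun (isOpen_stdCube ε).measurableSet fun y hy => by
    simp only [h (c + T y) ⟨y, hy, rfl⟩]

lemma rotCube_sub (z : EuclideanSpace ℝ (Fin n)) :
    rotCube ε T (c - z) = (· + z) ⁻¹' rotCube ε T c := by
  ext p
  simp only [mem_rotCube, Set.mem_preimage]
  rw [sub_sub_eq_add_sub]

/-- Mollification does not increase the sum of the sign integrals beyond the bound provided by
`kappa`. -/
lemma sum_signIntegral_mollify_le {ι : Type*} (hn : 1 ≤ n) (hε : 0 < ε)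
    {u v : EuclideanSpace ℝ (Fin n) → ℝ} {K Ω : Set (EuclideanSpace ℝ (Fin n))}
    (hu : Integrable u) (huv : ∀ x ∈ K, u x = v x) (hK : K ⊆ Ω) (i₀ : Fin n)
    (I : Finset ι) (T : ι → EuclideanSpace ℝ (Fin n) ≃ₗᵢ[ℝ] EuclideanSpace ℝ (Fin n))
    (c : ι → EuclideanSpace ℝ (Fin n))
    (hsub : ∀ i ∈ I, ∀ z, ‖z‖ < φ.rOut → rotCube ε (T i) (c i - z) ⊆ K)
    (hdisj : (I : Set ι).PairwiseDisjoint fun i => rotCube ε (T i) (c i))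
    (hfin : kappa n ε v Ω ≠ ⊤) :
    ∑ i ∈ I, signIntegral ε i₀ (T i) (c i) (mollify φ u) ≤ ε * (kappa n ε v Ω).toReal := by
  have h := fun i => signIntegral_mollify (ε := ε) (T := T i) (c := c i) φ i₀ hu
  simp only [fun i => (h i).2]
  rw [← integral_finsetSum _ fun i _ => (h i).1]
  have hbound : ∫ z, φ.normed volume z * (ε * (kappa n ε v Ω).toReal) =
      ε * (kappa n ε v Ω).toReal := by
    rw [integral_mul_const, φ.integral_normed, one_mul]
  rw [← hbound]
  refine integral_mono (integrable_finsetSum _ fun i _ => (h i).1)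
    (φ.integrable_normed.mul_const _) fun z => ?_
  simp only [← Finset.mul_sum]
  by_cases hz : ‖z‖ < φ.rOut
  · refine mul_le_mul_of_nonneg_left ?_ (φ.nonneg_normed z)
    have heq : ∀ i ∈ I, Set.EqOn u v (rotCube ε (T i) (c i - z)) :=
      fun i hi x hx => huv x (hsub i hi z hz hx)
    rw [Finset.sum_congr rfl fun i hi => signIntegral_congr i₀ (heq i hi)]
    refine sum_signIntegral_le hn hε i₀ I T (fun i => c i - z)
      (fun i hi => (hsub i hi z hz).trans hK) (fun i hi j hj hij => ?_) (fun i hi => ?_) hfin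
    · simp only [Function.onFun, rotCube_sub]
      exact (hdisj hi hj hij).preimage _
    · exact hu.integrableOn.congr_fun (heq i hi) ((measurableEmbedding_add_isometry _ _
        ).measurableSet_image.2 (isOpen_stdCube ε).measurableSet)
  · have : φ.normed volume z = 0 := by
      rw [← Function.notMem_support, φ.support_normed_eq]
      simpa using hz
    simp [this]

end SignIntegralMollify

section Divergence

variable {n : ℕ} {Φ : EuclideanSpace ℝ (Fin n) → EuclideanSpace ℝ (Fin n)}

lemma continuous_vdiv (hΦ : ContDiff ℝ 1 Φ) : Continuous (vdiv n Φ) := by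
  have := hΦ.continuous_fderiv one_ne_zero
  unfold vdiv
  fun_prop

lemma vdiv_eq_zero_of_notMem_tsupport {x : EuclideanSpace ℝ (Fin n)} (hx : x ∉ tsupport Φ) :
    vdiv n Φ x = 0 := by
  simp [vdiv, fderiv_of_notMem_tsupport ℝ hx]

lemma hasCompactSupport_vdiv (hΦ : HasCompactSupport Φ) : HasCompactSupport (vdiv n Φ) :=
  HasCompactSupport.intro hΦ fun _ hx => vdiv_eq_zero_of_notMem_tsupport hx

lemma integral_mul_vdiv (hΦ : ContDiff ℝ 1 Φ) (hc : HasCompactSupport Φ)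
    {g : EuclideanSpace ℝ (Fin n) → ℝ} (hg : ContDiff ℝ 1 g) :
    ∫ x, g x * vdiv n Φ x = - ∫ x, fderiv ℝ g x (Φ x) := by
  have hΦd : Differentiable ℝ Φ := hΦ.differentiable one_ne_zero
  have hcoord : ∀ i, ContDiff ℝ 1 fun x => Φ x i := fun i => by fun_prop
  have hcs : ∀ i, HasCompactSupport fun x => Φ x i := fun i =>
    hc.comp_left (g := fun y : EuclideanSpace ℝ (Fin n) => y i) rfl
  have hfd : ∀ i x, fderiv ℝ Φ x (EuclideanSpace.single i 1) i =
      fderiv ℝ (fun x => Φ x i) x (EuclideanSpace.single i 1) := fun i x => by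
    have := ((EuclideanSpace.proj (𝕜 := ℝ) i).hasFDerivAt.comp x (hΦd x).hasFDerivAt).fderiv
    exact (congrArg (fun A => A (EuclideanSpace.single i (1 : ℝ))) this).symm
  have hgc := hg.continuous
  have hgc' := hg.continuous_fderiv one_ne_zero
  have hi1 : ∀ i, Integrable fun x =>
      g x * fderiv ℝ (fun x => Φ x i) x (EuclideanSpace.single i 1) := fun i => by
    have := (hcoord i).continuous_fderiv one_ne_zero
    exact (by fun_prop : Continuous fun x =>
      g x * fderiv ℝ (fun x => Φ x i) x (EuclideanSpace.single i 1)).integrable_of_hasCompactSupport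
      (((hcs i).fderiv_apply ℝ _).mul_left)
  have hi2 : ∀ i, Integrable fun x => fderiv ℝ g x (EuclideanSpace.single i 1) * Φ x i :=
    fun i => (by fun_prop : Continuous fun x =>
      fderiv ℝ g x (EuclideanSpace.single i 1) * Φ x i).integrable_of_hasCompactSupport
      (hcs i).mul_left
  have hi3 : ∀ i, Integrable fun x => g x * Φ x i :=
    fun i => (by fun_prop : Continuous fun x => g x * Φ x i).integrable_of_hasCompactSupport
      (hcs i).mul_left
  have hsum : ∀ x, fderiv ℝ g x (Φ x) =
      ∑ i, fderiv ℝ g x (EuclideanSpace.single i 1) * Φ x i := fun x => by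
    conv_lhs => rw [← (EuclideanSpace.basisFun (Fin n) ℝ).sum_repr (Φ x)]
    simp [mul_comm]
  simp only [vdiv, hfd, hsum, Finset.mul_sum]
  rw [integral_finsetSum _ fun i _ => hi1 i, integral_finsetSum _ fun i _ => hi2 i,
    ← Finset.sum_neg_distrib]
  exact Finset.sum_congr rfl fun i _ => integral_mul_fderiv_eq_neg_fderiv_mul_of_integrable
    (hi2 i) (hi1 i) (hi3 i) (fun x _ => hg.differentiable one_ne_zero x)
    (fun x _ => (hcoord i).differentiable one_ne_zero x)

lemma integral_mul_vdiv_le (hΦ : ContDiff ℝ 1 Φ) (hc : HasCompactSupport Φ)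
    (hΦ1 : ∀ x, ‖Φ x‖ ≤ 1) {g : EuclideanSpace ℝ (Fin n) → ℝ} (hg : ContDiff ℝ 1 g) :
    ∫ x, g x * vdiv n Φ x ≤ ∫ x in tsupport Φ, ‖fderiv ℝ g x‖ := by
  have hgc' := hg.continuous_fderiv one_ne_zero
  have hΦc := hΦ.continuous
  rw [integral_mul_vdiv hΦ hc hg, ← integral_neg,
    ← setIntegral_eq_integral_of_forall_compl_eq_zero (s := tsupport Φ) fun x hx => by
      rw [image_eq_zero_of_notMem_tsupport hx, map_zero, neg_zero]]
  refine integral_mono ((by fun_prop : Continuous fun x => -fderiv ℝ g x (Φ x)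
    ).continuousOn.integrableOn_compact hc)
    (hgc'.norm.continuousOn.integrableOn_compact hc) fun x => ?_
  calc -fderiv ℝ g x (Φ x) ≤ ‖fderiv ℝ g x (Φ x)‖ := neg_le_abs _
    _ ≤ ‖fderiv ℝ g x‖ * ‖Φ x‖ := (fderiv ℝ g x).le_opNorm _
    _ ≤ ‖fderiv ℝ g x‖ := mul_le_of_le_one_right (norm_nonneg _) (hΦ1 x)

end Divergence

section Packing

variable {n : ℕ}

lemma eventually_mul_lt (a : ℝ) {δ : ℝ} (hδ : 0 < δ) : ∀ᶠ ε in 𝓝[>] (0 : ℝ), a * ε < δ := by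
  have h : Tendsto (fun ε : ℝ => a * ε) (𝓝 0) (𝓝 0) := by
    simpa using (continuous_const_mul a).tendsto 0
  exact (h.mono_left nhdsWithin_le_nhds).eventually_lt_const hδ

/-- For every sufficiently small `ε` there are disjoint cubes of side length `ε` centred near `K`
and oriented along the gradient of `g`, for which the sum of the sign integrals of any small
Lipschitz perturbation of `g` almost exceeds a quarter of the total variation of `g` on `K`. -/
lemma exists_eventually_exists_cubes (i₀ : Fin n) {g : EuclideanSpace ℝ (Fin n) → ℝ}
    (hg : ContDiff ℝ 1 g) (hgc : HasCompactSupport g) {K : Set (EuclideanSpace ℝ (Fin n))}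
    (hK : IsCompact K) {η : ℝ} (hη : 0 < η) :
    ∃ η₁ > 0, ∀ᶠ ε in 𝓝[>] (0 : ℝ),
      ∃ (I : Finset (Σ _ : Fin n → ℤ, EuclideanSpace ℝ (Fin n)))
        (T : (Σ _ : Fin n → ℤ, EuclideanSpace ℝ (Fin n)) →
          EuclideanSpace ℝ (Fin n) ≃ₗᵢ[ℝ] EuclideanSpace ℝ (Fin n))
        (c : (Σ _ : Fin n → ℤ, EuclideanSpace ℝ (Fin n)) → EuclideanSpace ℝ (Fin n)),
        (I : Set _).PairwiseDisjoint (fun i => rotCube ε (T i) (c i)) ∧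
        (∀ i ∈ I, ∃ p ∈ K, dist p (c i) ≤ n * ε) ∧
        ∀ u : EuclideanSpace ℝ (Fin n) → ℝ, Continuous u →
          (∀ x y, |(u x - g x) - (u y - g y)| ≤ η₁ * ‖x - y‖) →
          ε * ((∫ x in K, ‖fderiv ℝ g x‖) / 4 - η) ≤
            ∑ i ∈ I, signIntegral ε i₀ (T i) (c i) u := by
  have hV : 0 ≤ volume.real K := measureReal_nonneg
  obtain ⟨η₁, hη₁, hη₁'⟩ : ∃ η₁ > 0, η₁ * (1 + 3 * n * volume.real K) ≤ η :=
    ⟨η / (1 + 3 * n * volume.real K), by positivity, (div_mul_cancel₀ _ (by positivity)).le⟩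
  have hg' := hg.continuous_fderiv one_ne_zero
  set D := InnerProductSpace.toDual ℝ (EuclideanSpace ℝ (Fin n))
  obtain ⟨J, C, w, hC, hCK, hCd, hCw, hCi⟩ := exists_nearly_constant_pieces
    (G := fun x => D.symm (fderiv ℝ g x)) (by fun_prop) hK hη₁
  simp only [LinearIsometryEquiv.norm_map] at hCi
  choose T hT using fun j => exists_isometry_single i₀ (w j)
  obtain ⟨r, hr, hgr⟩ := Metric.uniformContinuous_iff.1
    ((hgc.fderiv ℝ).uniformContinuous_of_continuous hg') η₁ hη₁
  refine ⟨η₁, hη₁, ?_⟩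
  have hthick : ∀ᶠ ε in 𝓝[>] (0 : ℝ), ∀ i ∈ J, ∀ j ∈ J, i ≠ j →
      Disjoint (thickening (2 * n * ε + ε) (C i)) (thickening (2 * n * ε + ε) (C j)) := by
    refine (Finset.eventually_all J).2 fun i _ => (Finset.eventually_all J).2 fun j _ => ?_
    by_cases hij : i = j
    · simp [hij]
    obtain ⟨δ, hδ, hd⟩ := (hCd i j hij).exists_thickenings (hC i) (hC j).isClosed
    filter_upwards [eventually_mul_lt (2 * n + 1) hδ] with ε hε _
    have hle : 2 * n * ε + ε ≤ δ := by linarith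
    exact hd.mono (thickening_mono hle _) (thickening_mono hle _)
  filter_upwards [hthick, eventually_mul_lt (2 * n) hr, self_mem_nhdsWithin] with ε hdε hrε hε
  replace hε : 0 < ε := hε
  choose S hSd hSC hSv using fun j =>
    exists_disjoint_rotCubes (T j) (hC j) hε (‖w j‖ / 4 - n * (3 * η₁))
  refine ⟨J.sigma S, fun i => T i.1, fun i => i.2, ?_, ?_, fun u hu hug => ?_⟩
  · have hmem : ∀ i ∈ J.sigma S, rotCube ε (T i.1) i.2 ⊆ thickening (2 * n * ε + ε) (C i.1) := by
      intro i hi p hp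
      obtain ⟨q, hq, hqi⟩ := hSC i.1 i.2 (Finset.mem_sigma.1 hi).2
      have h1 := dist_le_of_mem_rotCube hε.le hp
      have h2 := dist_triangle_right p q i.2
      exact mem_thickening_iff.2 ⟨q, hq, by linarith⟩
    rintro ⟨i, a⟩ hi ⟨j, b⟩ hj hij
    by_cases h : i = j
    · subst h
      exact hSd i (Finset.mem_sigma.1 hi).2 (Finset.mem_sigma.1 hj).2 fun h => hij (by simpa using h)
    · exact (hdε i (Finset.mem_sigma.1 hi).1 j (Finset.mem_sigma.1 hj).1 h).mono
        (hmem _ hi) (hmem _ hj)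
  · intro i hi
    obtain ⟨q, hq, hqi⟩ := hSC i.1 i.2 (Finset.mem_sigma.1 hi).2
    exact ⟨q, hCK _ hq, hqi⟩
  · have hcube : ∀ j, ∀ c ∈ S j, ε ^ (n + 1) * (‖w j‖ / 4 - n * (3 * η₁)) ≤
        signIntegral ε i₀ (T j) c u := by
      intro j c hc
      obtain ⟨q, hq, hqc⟩ := hSC j c hc
      refine le_signIntegral hε.le i₀ (hT j) (by positivity) ?_ fun p hp => ?_
      · exact (hu.continuousOn.integrableOn_compact (isCompact_closedBall c (n * ε))).mono_set
          fun p hp => dist_le_of_mem_rotCube hε.le hp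
      · have hlin : ‖g p - g c - D (w j) (p - c)‖ ≤ 2 * η₁ * ‖p - c‖ := by
          refine (convex_closedBall c (n * ε)).norm_image_sub_le_of_norm_fderiv_le'
            (fun x _ => hg.differentiable one_ne_zero x) (fun x hx => ?_)
            (mem_closedBall_self (by positivity)) (dist_le_of_mem_rotCube hε.le hp)
          have hx' : dist x q < r := by
            have h2 := dist_triangle_right x q c
            linarith [mem_closedBall.1 hx]
          have h3 : ‖fderiv ℝ g q - D (w j)‖ ≤ η₁ := by
            rw [← D.symm.norm_map, map_sub, D.symm_apply_apply]
            exact hCw j q hq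
          have h4 := hgr hx'
          rw [dist_eq_norm] at h4
          calc ‖fderiv ℝ g x - D (w j)‖
              ≤ ‖fderiv ℝ g x - fderiv ℝ g q‖ + ‖fderiv ℝ g q - D (w j)‖ :=
                norm_sub_le_norm_sub_add_norm_sub _ _ _
            _ ≤ 2 * η₁ := by linarith
        have hD : D (w j) (p - c) = ⟪w j, p - c⟫ := InnerProductSpace.toDual_apply_apply ..
        rw [hD, Real.norm_eq_abs] at hlin
        calc |u p - u c - ⟪w j, p - c⟫|
            = |(u p - g p - (u c - g c)) + (g p - g c - ⟪w j, p - c⟫)| := by ring_nf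
          _ ≤ |u p - g p - (u c - g c)| + |g p - g c - ⟪w j, p - c⟫| := abs_add_le _ _
          _ ≤ 3 * η₁ * ‖p - c‖ := by linarith [hug p c]
    have hvol : ∑ j ∈ J, volume.real (C j) ≤ volume.real K := by
      rw [← measureReal_biUnion_finset (fun i _ j _ hij => hCd i j hij)
        (fun j _ => (hC j).measurableSet) fun j _ => (hC j).measure_lt_top.ne]
      exact measureReal_mono (Set.iUnion₂_subset fun j _ => hCK j) hK.measure_lt_top.ne
    have hlower : (∫ x in K, ‖fderiv ℝ g x‖) / 4 - η ≤
        ∑ j ∈ J, volume.real (C j) * (‖w j‖ / 4 - n * (3 * η₁)) := by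
      have h1 : ∑ j ∈ J, volume.real (C j) * (‖w j‖ / 4 - n * (3 * η₁)) =
          (∑ j ∈ J, volume.real (C j) * ‖w j‖) / 4 -
            (∑ j ∈ J, volume.real (C j)) * (n * (3 * η₁)) := by
        rw [Finset.sum_div, Finset.sum_mul, ← Finset.sum_sub_distrib]
        exact Finset.sum_congr rfl fun j _ => by ring
      have h2 : (∑ j ∈ J, volume.real (C j)) * (n * (3 * η₁)) ≤
          volume.real K * (n * (3 * η₁)) := by gcongr
      rw [h1]
      linarith
    calc ε * ((∫ x in K, ‖fderiv ℝ g x‖) / 4 - η)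
        ≤ ε * ∑ j ∈ J, (S j).card * ε ^ n * (‖w j‖ / 4 - n * (3 * η₁)) := by
          gcongr
          exact hlower.trans (Finset.sum_le_sum fun j _ => hSv j)
      _ = ∑ j ∈ J, ∑ _c ∈ S j, ε ^ (n + 1) * (‖w j‖ / 4 - n * (3 * η₁)) := by
          rw [Finset.mul_sum]
          refine Finset.sum_congr rfl fun j _ => ?_
          rw [Finset.sum_const, nsmul_eq_mul]
          ring
      _ ≤ ∑ j ∈ J, ∑ c ∈ S j, signIntegral ε i₀ (T j) c u :=
          Finset.sum_le_sum fun j _ => Finset.sum_le_sum fun c hc => hcube j c hc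
      _ = ∑ i ∈ J.sigma S, signIntegral ε i₀ (T i.1) i.2 u :=
          (Finset.sum_sigma J S fun i => signIntegral ε i₀ (T i.1) i.2 u).symm

end Packing

lemma eventually_ofReal_integral_div_four_sub_le_kappa {n : ℕ} (hn : 1 ≤ n)
    {Ω : Set (EuclideanSpace ℝ (Fin n))} (hΩ : IsOpen Ω)
    {f : EuclideanSpace ℝ (Fin n) → ℝ} (hf : LocallyIntegrableOn f Ω volume)
    {F : ℝ → EuclideanSpace ℝ (Fin n) → ℝ}
    (hFloc : ∀ ε, 0 < ε → LocallyIntegrableOn (F ε) Ω volume)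
    (hconv : ∀ K, IsCompact K → K ⊆ Ω →
      Tendsto (fun ε => ∫ x in K, |F ε x - f x|) (𝓝[>] (0 : ℝ)) (𝓝 0))
    {Φ : EuclideanSpace ℝ (Fin n) → EuclideanSpace ℝ (Fin n)}
    (hΦ : ContDiff ℝ 1 Φ) (hc : HasCompactSupport Φ) (hΦΩ : tsupport Φ ⊆ Ω)
    (hΦ1 : ∀ x, ‖Φ x‖ ≤ 1) {η : ℝ} (hη : 0 < η) :
    ∀ᶠ ε in 𝓝[>] (0 : ℝ),
      ENNReal.ofReal ((∫ x in Ω, f x * vdiv n Φ x) / 4 - 2 * η) ≤ kappa n ε (F ε) Ω := by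
  obtain ⟨δ, hδ, hδΩ⟩ := hc.isCompact.exists_cthickening_subset_open hΩ hΦΩ
  set K := cthickening δ (tsupport Φ)
  have hK : IsCompact K := hc.isCompact.cthickening
  have hKm : MeasurableSet K := hK.measurableSet
  have hfK : Integrable (K.indicator f) :=
    (integrable_indicator_iff hKm).2 (hf.integrableOn_compact_subset hδΩ hK)
  have hI : ∫ x in Ω, f x * vdiv n Φ x = ∫ x, K.indicator f x * vdiv n Φ x := by
    simp only [← Set.indicator_mul_left]
    rw [integral_indicator hKm]
    refine setIntegral_eq_of_subset_of_forall_sdiff_eq_zero (μ := volume) hΩ.measurableSet hδΩ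
      fun x hx => ?_
    rw [vdiv_eq_zero_of_notMem_tsupport fun h => hx.2 (self_subset_cthickening _ h), mul_zero]
  have hfn : 0 ≤ ∫ x, |K.indicator f x| := integral_nonneg fun _ => abs_nonneg _
  obtain ⟨r, hr, hvr⟩ := Metric.uniformContinuous_iff.1
    ((hasCompactSupport_vdiv hc).uniformContinuous_of_continuous (continuous_vdiv hΦ))
    (η / (1 + ∫ x, |K.indicator f x|)) (by positivity)
  obtain ⟨φ, hφδ, hφr⟩ : ∃ φ : ContDiffBump (0 : EuclideanSpace ℝ (Fin n)),
      φ.rOut ≤ δ / 2 ∧ φ.rOut ≤ r :=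
    ⟨⟨min (δ / 2) r / 2, min (δ / 2) r, by positivity, by
      have : 0 < min (δ / 2) r := by positivity
      linarith⟩, min_le_left _ _, min_le_right _ _⟩
  have hmoll := abs_integral_mul_sub_integral_mollify_mul_le φ hfK (continuous_vdiv hΦ)
    (hasCompactSupport_vdiv hc) fun x z hz =>
      (hvr (a := x + z) (b := x) (by simpa using hz.trans_le hφr)).le
  have hsmall : η / (1 + ∫ x, |K.indicator f x|) * ∫ x, |K.indicator f x| ≤ η := by
    rw [div_mul_eq_mul_div, div_le_iff₀ (by positivity)]
    nlinarith
  have hg : ContDiff ℝ 1 (mollify φ (K.indicator f)) := contDiff_mollify φ hfK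
  have hgc : HasCompactSupport (mollify φ (K.indicator f)) :=
    hasCompactSupport_mollify φ (HasCompactSupport.intro hK fun x hx => by simp [hx])
  obtain ⟨η₁, hη₁, hcubes⟩ :=
    exists_eventually_exists_cubes ⟨0, hn⟩ hg hgc hc.isCompact hη
  obtain ⟨L, hL, hLip⟩ := exists_lipschitz_mollify φ
  have hclose : ∀ᶠ ε in 𝓝[>] (0 : ℝ), L * ∫ x in K, |F ε x - f x| < η₁ := by
    have h := (hconv K hK hδΩ).const_mul L
    rw [mul_zero] at h
    exact h.eventually_lt_const hη₁
  filter_upwards [hcubes, hclose, eventually_mul_lt (2 * n) (half_pos hδ), self_mem_nhdsWithin]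
    with ε hcε hclε hnε hε
  replace hε : 0 < ε := hε
  by_cases hfin : kappa n ε (F ε) Ω = ⊤
  · simp [hfin]
  obtain ⟨I, T, c, hdisj, hnear, hlow⟩ := hcε
  have hFK : Integrable (K.indicator (F ε)) :=
    (integrable_indicator_iff hKm).2 ((hFloc ε hε).integrableOn_compact_subset hδΩ hK)
  have hL1 : ∫ t, |K.indicator (F ε) t - K.indicator f t| = ∫ x in K, |F ε x - f x| := by
    rw [← integral_indicator hKm]
    congr 1 with t
    by_cases ht : t ∈ K <;> simp [ht]
  have h1 := hlow (mollify φ (K.indicator (F ε))) (contDiff_mollify φ hFK).continuous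
    fun x y => by
      rw [← mollify_sub φ hFK hfK, ← mollify_sub φ hFK hfK]
      refine (hLip _ (hFK.sub hfK) x y).trans ?_
      simp only [Pi.sub_apply, hL1]
      gcongr
  have h2 := sum_signIntegral_mollify_le φ hn hε hFK
    (fun x hx => Set.indicator_of_mem hx (F ε)) hδΩ ⟨0, hn⟩ I T c (fun i hi z hz p hp => by
      obtain ⟨q, hq, hqi⟩ := hnear i hi
      refine mem_cthickening_of_dist_le p q δ _ hq ?_
      have h3 := dist_le_of_mem_rotCube hε.le hp
      have h4 : dist (c i - z) (c i) = ‖z‖ := by simp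
      have h5 := dist_triangle4 p (c i - z) (c i) q
      rw [dist_comm (c i) q] at h5
      linarith) hdisj hfin
  have h3 := le_of_mul_le_mul_left (h1.trans h2) hε
  refine ENNReal.ofReal_le_of_le_toReal (le_trans ?_ h3)
  have h4 := integral_mul_vdiv_le hΦ hc hΦ1 hg
  have h5 := (abs_le.1 hmoll).1
  rw [hI]
  linarith

lemma variation_div_four_le_liminf_kappa {n : ℕ} (hn : 1 ≤ n)
    {Ω : Set (EuclideanSpace ℝ (Fin n))} (hΩ : IsOpen Ω)
    {f : EuclideanSpace ℝ (Fin n) → ℝ} (hf : LocallyIntegrableOn f Ω volume)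
    {F : ℝ → EuclideanSpace ℝ (Fin n) → ℝ}
    (hFloc : ∀ ε, 0 < ε → LocallyIntegrableOn (F ε) Ω volume)
    (hconv : ∀ K, IsCompact K → K ⊆ Ω →
      Tendsto (fun ε => ∫ x in K, |F ε x - f x|) (𝓝[>] (0 : ℝ)) (𝓝 0)) :
    variation n f Ω / 4 ≤ liminf (fun ε => kappa n ε (F ε) Ω) (𝓝[>] (0 : ℝ)) := by
  refine ENNReal.div_le_of_le_mul (iSup_le fun Φ => iSup_le fun hΦ => iSup_le fun hc =>
    iSup_le fun hΦΩ => iSup_le fun hΦ1 => ?_)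
  rw [← ENNReal.div_le_iff_le_mul (by simp) (by simp)]
  refine ENNReal.le_of_forall_pos_le_add fun η hη _ => ?_
  have h := le_liminf_of_le (by isBoundedDefault)
    (eventually_ofReal_integral_div_four_sub_le_kappa hn hΩ hf hFloc hconv hΦ hc hΦΩ hΦ1
      (half_pos (NNReal.coe_pos.2 hη)))
  rw [mul_div_cancel₀ _ two_ne_zero, ENNReal.ofReal_sub _ η.coe_nonneg, ENNReal.ofReal_coe_nnreal,
    tsub_le_iff_right, ENNReal.ofReal_div_of_pos (by norm_num)] at h
  simpa using h

/-- Lower bound for the `Γ`-limit with respect to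
`L¹_loc`-convergence: `(1/4)·Var(f, Ω) ≤ liminf_{ε→0} κ_ε(f_ε, Ω)`. -/
theorem quarter_variation_le_liminf_kappa
    (n : ℕ) (hn : 1 ≤ n)
    (Ω : Set (EuclideanSpace ℝ (Fin n))) (hΩ : IsOpen Ω)
    (f : EuclideanSpace ℝ (Fin n) → ℝ) (hf : LocallyIntegrableOn f Ω volume)
    (F : ℝ → EuclideanSpace ℝ (Fin n) → ℝ)
    (hFloc : ∀ ε, 0 < ε → LocallyIntegrableOn (F ε) Ω volume)
    (hconv : ∀ K, IsCompact K → K ⊆ Ω →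
      Tendsto (fun ε => ∫ x in K, |F ε x - f x|) (𝓝[>] (0:ℝ)) (𝓝 0)) :
    variation n f Ω / 4 ≤ liminf (fun ε => kappa n ε (F ε) Ω) (𝓝[>] (0:ℝ)) ∧
    (liminf (fun ε => kappa n ε (F ε) Ω) (𝓝[>] (0:ℝ)) < ⊤ →
      variation n f Ω < ⊤) := by
  have h := variation_div_four_le_liminf_kappa hn hΩ hf hFloc hconv
  refine ⟨h, fun hlt => ?_⟩
  by_contra hv
  rw [not_lt_top_iff.1 hv, ENNReal.top_div_of_ne_top (by simp)] at h
  exact (h.trans_lt hlt).ne rfl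

end
end

section
/- Let n ≥ 1, let Ω' ⋐ Ω'' ⋐ Ω be open subsets of ℝ^n, let 0 < δ < dist(Ω', ℝ^n \ Ω''), let ρ_δ(x) := δ^{-n} ρ(x/δ) for a standard mollifier ρ, let f ∈ L^1_loc(Ω), and let {f_ε}_{ε>0} be a family with f_ε → f in L^1(Ω'') as ε → 0. Then limsup_{ε→0} κ_ε(ρ_δ * (f − f_ε), Ω') = 0. -/
open MeasureTheory Filter Topology Metric
open scoped ENNReal RealInnerProductSpace Classical

noncomputable section

lemma IsCube.measurableSet {n : ℕ} {ε : ℝ} {Q : Set (EuclideanSpace ℝ (Fin n))}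
    (hQ : IsCube n ε Q) : MeasurableSet Q := by
  obtain ⟨T, x, rfl⟩ := hQ
  have hopen : IsOpen {y : EuclideanSpace ℝ (Fin n) | ∀ i, |y i| < ε / 2} := by
    simp only [Set.ofPred_forall]
    exact isOpen_iInter_of_finite fun i => isOpen_lt (by fun_prop) continuous_const
  exact ((T.toHomeomorph.trans (Homeomorph.addLeft x)).isOpenMap _ hopen).measurableSet

lemma IsCube.volume_eq {n : ℕ} {ε : ℝ} {Q : Set (EuclideanSpace ℝ (Fin n))}
    (hQ : IsCube n ε Q) : volume Q = ENNReal.ofReal ε ^ n := by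
  obtain ⟨T, x, rfl⟩ := hQ
  have himg : (fun y => x + T y) '' {y : EuclideanSpace ℝ (Fin n) | ∀ i, |y i| < ε / 2} =
      (fun y => x + y) '' (T '' {y : EuclideanSpace ℝ (Fin n) | ∀ i, |y i| < ε / 2}) := by
    rw [Set.image_image]
  have hpre : {y : EuclideanSpace ℝ (Fin n) | ∀ i, |y i| < ε / 2} =
      (@WithLp.ofLp 2 (Fin n → ℝ)) ⁻¹' (Set.univ.pi fun _ => Set.Ioo (-(ε / 2)) (ε / 2)) := by
    ext y
    simp [abs_lt]
  rw [himg, Set.image_add_left, measure_preimage_add, T.image_eq_preimage_symm,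
    T.symm.measurePreserving.measure_preimage_emb T.symm.toHomeomorph.measurableEmbedding, hpre,
    (PiLp.volume_preserving_ofLp (Fin n)).measure_preimage
      (MeasurableSet.univ_pi fun _ => measurableSet_Ioo).nullMeasurableSet, volume_pi_pi]
  simp

lemma IsCube.dist_le {n : ℕ} {ε : ℝ} {Q : Set (EuclideanSpace ℝ (Fin n))}
    (hQ : IsCube n ε Q) (hε : 0 ≤ ε) {x y : EuclideanSpace ℝ (Fin n)} (hx : x ∈ Q)
    (hy : y ∈ Q) : dist x y ≤ √n * ε := by
  obtain ⟨T, c, rfl⟩ := hQ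
  obtain ⟨u, hu, rfl⟩ := hx
  obtain ⟨v, hv, rfl⟩ := hy
  simp only [dist_add_left, T.dist_map]
  rw [EuclideanSpace.dist_eq]
  apply Real.sqrt_le_iff.2 ⟨by positivity, ?_⟩
  calc ∑ i, dist (u i) (v i) ^ 2 ≤ ∑ _i : Fin n, ε ^ 2 := by
        gcongr with i
        have h₁ := abs_lt.1 (hu i)
        have h₂ := abs_lt.1 (hv i)
        rw [Real.dist_eq, abs_le]
        constructor <;> linarith
    _ = (√n * ε) ^ 2 := by
        rw [mul_pow, Real.sq_sqrt (Nat.cast_nonneg n)]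
        simp

/-- The mean oscillation of a function on a set is at most its oscillation. -/
lemma setAverage_abs_sub_setAverage_le {α : Type*} [MeasurableSpace α] {μ : Measure α}
    {s : Set α} (hs : MeasurableSet s) (h0 : μ s ≠ 0) (ht : μ s ≠ ∞) {g : α → ℝ} {D : ℝ}
    (hg : IntegrableOn g s μ) (hD : ∀ x ∈ s, ∀ y ∈ s, |g x - g y| ≤ D) :
    ⨍ x in s, |g x - ⨍ y in s, g y ∂μ| ∂μ ≤ D := by
  have hmean : ∀ x ∈ s, |g x - ⨍ y in s, g y ∂μ| ≤ D := fun x hx => by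
    have hmem : (⨍ y in s, g y ∂μ) ∈ closedBall (g x) D :=
      (convex_closedBall _ _).set_average_mem isClosed_closedBall h0 ht
        ((ae_restrict_iff' hs).2 (Eventually.of_forall fun y hy => by
          rw [mem_closedBall, Real.dist_eq]
          exact hD y hy x hx)) hg
    rwa [mem_closedBall', Real.dist_eq] at hmem
  exact (convex_Iic D).set_average_mem isClosed_Iic h0 ht
    ((ae_restrict_iff' hs).2 (Eventually.of_forall hmean))
    (hg.sub (integrableOn_const ht)).abs

lemma IsCube.mean_oscillation_le {n : ℕ} {ε : ℝ} {Q : Set (EuclideanSpace ℝ (Fin n))}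
    (hQ : IsCube n ε Q) (hε : 0 < ε) {g : EuclideanSpace ℝ (Fin n) → ℝ} {C : NNReal}
    (hg : LipschitzWith C g) :
    ⨍ x in Q, |g x - ⨍ y in Q, g y ∂volume| ∂volume ≤ C * (√n * ε) := by
  have h0 : volume Q ≠ 0 := by simp [hQ.volume_eq, hε]
  have ht : volume Q ≠ ∞ := by simp [hQ.volume_eq]
  have hosc : ∀ x ∈ Q, ∀ y ∈ Q, |g x - g y| ≤ C * (√n * ε) := fun x hx y hy =>
    (hg.dist_le_mul x y).trans (by gcongr; exact hQ.dist_le hε.le hx hy)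
  obtain ⟨z, hz⟩ := nonempty_of_measure_ne_zero h0
  refine setAverage_abs_sub_setAverage_le hQ.measurableSet h0 ht ?_ hosc
  refine IntegrableOn.of_bound ht.lt_top hg.continuous.aestronglyMeasurable
    (|g z| + C * (√n * ε)) ((ae_restrict_iff' hQ.measurableSet).2 (Eventually.of_forall ?_))
  intro x hx
  calc ‖g x‖ = |g z + (g x - g z)| := by simp
    _ ≤ |g z| + |g x - g z| := abs_add_le _ _
    _ ≤ _ := by gcongr; exact hosc x hx z hz

lemma kappa_le_of_lipschitzWith {n : ℕ} (hn : 1 ≤ n) {ε : ℝ} (hε : 0 < ε)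
    {g : EuclideanSpace ℝ (Fin n) → ℝ} {C : NNReal} (hg : LipschitzWith C g)
    (Ω : Set (EuclideanSpace ℝ (Fin n))) :
    kappa n ε g Ω ≤ ENNReal.ofReal (C * √n) * volume Ω := by
  simp only [kappa, ENNReal.mul_iSup]
  refine iSup_le fun F => iSup_le fun hF => iSup_le fun hdisj => ?_
  rw [← ENNReal.tsum_mul_left]
  calc ∑' Q : F, ENNReal.ofReal (ε ^ (n - 1)) * ENNReal.ofReal
        (⨍ x in (Q : Set (EuclideanSpace ℝ (Fin n))),
          |g x - ⨍ y in (Q : Set (EuclideanSpace ℝ (Fin n))), g y ∂volume| ∂volume)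
      ≤ ∑' Q : F, ENNReal.ofReal (C * √n) * volume (Q : Set (EuclideanSpace ℝ (Fin n))) := by
        refine ENNReal.tsum_le_tsum fun Q => ?_
        have hQ := (hF Q Q.2).1
        rw [hQ.volume_eq, ← ENNReal.ofReal_pow hε.le, ← ENNReal.ofReal_mul (by positivity),
          ← ENNReal.ofReal_mul (by positivity)]
        apply ENNReal.ofReal_le_ofReal
        calc _ ≤ ε ^ (n - 1) * (C * (√n * ε)) := by
              gcongr
              exact hQ.mean_oscillation_le hε hg
          _ = C * √n * ε ^ (n - 1 + 1) := by ring
          _ = C * √n * ε ^ n := by rw [Nat.sub_add_cancel hn]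
    _ = ENNReal.ofReal (C * √n) * ∑' Q : F, volume (Q : Set (EuclideanSpace ℝ (Fin n))) :=
        ENNReal.tsum_mul_left
    _ ≤ ENNReal.ofReal (C * √n) * volume Ω := by
        gcongr
        refine (tsum_meas_le_meas_iUnion_of_disjoint volume
          (fun Q : F => (hF Q Q.2).1.measurableSet) fun P Q hPQ =>
            hdisj P.2 Q.2 fun h => hPQ (Subtype.ext h)).trans ?_
        exact measure_mono (Set.iUnion_subset fun Q => (hF Q Q.2).2)

/-- Convolution of an integrable function with a bounded Lipschitz kernel is Lipschitz. -/
lemma lipschitzWith_setIntegral_kernel_mul {E : Type*} [NormedAddCommGroup E]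
    [MeasurableSpace E] [BorelSpace E] {μ : Measure E} {s : Set E} {K h : E → ℝ} {L : NNReal}
    (hK : LipschitzWith L K) {M : ℝ} (hM : ∀ x, ‖K x‖ ≤ M) (hh : IntegrableOn h s μ) :
    LipschitzWith (L * (∫ y in s, |h y| ∂μ).toNNReal) fun x => ∫ y in s, K (x - y) * h y ∂μ := by
  have hint : ∀ x, Integrable (fun y => K (x - y) * h y) (μ.restrict s) := fun x =>
    hh.bdd_mul (hK.continuous.comp (continuous_sub_left x)).measurable.aestronglyMeasurable
      (Eventually.of_forall fun y => hM (x - y))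
  refine LipschitzWith.of_dist_le_mul fun x z => ?_
  rw [Real.dist_eq, ← integral_sub (hint x) (hint z), NNReal.coe_mul,
    Real.coe_toNNReal _ (integral_nonneg fun _ => abs_nonneg _)]
  calc ‖∫ y in s, (K (x - y) * h y - K (z - y) * h y) ∂μ‖
      ≤ ∫ y in s, L * dist x z * |h y| ∂μ := by
        refine norm_integral_le_of_norm_le (hh.abs.const_mul _) (Eventually.of_forall fun y => ?_)
        rw [← sub_mul, norm_mul, Real.norm_eq_abs (h y)]
        gcongr
        simpa [dist_eq_norm] using hK.norm_sub_le (x - y) (z - y)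
    _ = L * (∫ y in s, |h y| ∂μ) * dist x z := by
        rw [integral_const_mul]
        ring

/-- If `f_ε → f` in `L¹(Ω'')`, then
`limsup_{ε→0} κ_ε(ρ_δ * (f − f_ε), Ω') = 0`. -/
theorem limsup_kappa_mollified_difference_eq_zero
    (n : ℕ) (hn : 1 ≤ n)
    (Ω Ω'' Ω' : Set (EuclideanSpace ℝ (Fin n)))
    (hΩ : IsOpen Ω) (hΩ'' : IsOpen Ω'') (hΩ' : IsOpen Ω')
    (hΩ'cpt : IsCompact (closure Ω')) (hΩ'sub : closure Ω' ⊆ Ω'')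
    (hΩ''cpt : IsCompact (closure Ω'')) (hΩ''sub : closure Ω'' ⊆ Ω)
    (δ : ℝ) (hδ : 0 < δ)
    (hdist : ∀ x ∈ Ω', ∀ y, y ∉ Ω'' → δ < dist x y)
    (ρ : EuclideanSpace ℝ (Fin n) → ℝ)
    (hρsmooth : ContDiff ℝ (⊤ : ℕ∞) ρ) (hρnonneg : ∀ x, 0 ≤ ρ x)
    (hρsupp : tsupport ρ ⊆ Metric.closedBall 0 1) (hρint : ∫ x, ρ x = 1)
    (f : EuclideanSpace ℝ (Fin n) → ℝ) (hf : LocallyIntegrableOn f Ω volume)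
    (F : ℝ → EuclideanSpace ℝ (Fin n) → ℝ)
    (hF : ∀ ε, 0 < ε → IntegrableOn (F ε) Ω'' volume)
    (hconv : Tendsto (fun ε => ∫ x in Ω'', |F ε x - f x|) (𝓝[>] (0:ℝ)) (𝓝 0)) :
    limsup (fun ε => kappa n ε
        (fun x => ∫ y in Ω'', (δ ^ n)⁻¹ * ρ (δ⁻¹ • (x - y)) * (f y - F ε y)) Ω')
      (𝓝[>] (0:ℝ)) = 0 := by
  have hρcpt : HasCompactSupport ρ :=
    (isCompact_closedBall 0 1).of_isClosed_subset (isClosed_tsupport ρ) hρsupp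
  obtain ⟨C, hC⟩ := hρsmooth.lipschitzWith_of_hasCompactSupport hρcpt (by simp)
  obtain ⟨M, hM⟩ := hρcpt.exists_bound_of_continuous hρsmooth.continuous
  set K : EuclideanSpace ℝ (Fin n) → ℝ := fun z => (δ ^ n)⁻¹ * ρ (δ⁻¹ • z) with hK
  obtain ⟨L, hL⟩ : ∃ L, LipschitzWith L K :=
    ⟨_, (lipschitzWith_smul ((δ ^ n)⁻¹)).comp (hC.comp (lipschitzWith_smul δ⁻¹))⟩
  have hKM : ∀ z, ‖K z‖ ≤ ‖(δ ^ n)⁻¹‖ * M := fun z => by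
    rw [hK, norm_mul]
    gcongr
    exact hM _
  have hf'' : IntegrableOn f Ω'' volume :=
    (hf.integrableOn_compact_subset hΩ''sub hΩ''cpt).mono_set subset_closure
  have hvol : volume Ω' ≠ ∞ := (measure_mono subset_closure).trans_lt hΩ'cpt.measure_lt_top |>.ne
  have hle : ∀ᶠ ε in 𝓝[>] (0 : ℝ), kappa n ε
      (fun x => ∫ y in Ω'', (δ ^ n)⁻¹ * ρ (δ⁻¹ • (x - y)) * (f y - F ε y)) Ω' ≤
      ENNReal.ofReal (L * (∫ x in Ω'', |F ε x - f x|) * √n) * volume Ω' := by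
    filter_upwards [self_mem_nhdsWithin] with ε hε
    have hlip := lipschitzWith_setIntegral_kernel_mul hL hKM (hf''.sub (hF ε hε))
    refine (kappa_le_of_lipschitzWith hn hε hlip Ω').trans_eq ?_
    rw [NNReal.coe_mul, Real.coe_toNNReal _ (integral_nonneg fun _ => abs_nonneg _)]
    simp [abs_sub_comm]
  refine Tendsto.limsup_eq (tendsto_of_tendsto_of_tendsto_of_le_of_le' tendsto_const_nhds ?_
    (Eventually.of_forall fun _ => zero_le) hle)
  have hlim := ENNReal.Tendsto.mul_const (b := volume Ω')
    (ENNReal.tendsto_ofReal ((hconv.const_mul (L : ℝ)).mul_const √n)) (Or.inr hvol)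
  simpa using hlim

end
end
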